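/- arXiv:1301.6447 — 2 statements merged into one kernel-verified Lean document; each statement's English description precedes it below -/
import Mathlib

section
/- There exist absolute constants C > 0 and ε₀, δ₀ > 0 such that the following holds. Let A be an M × N complex matrix and let 𝒜 be an (ε,δ)-differentially private algorithm with ε ≤ ε₀ and δ ≤ δ₀. Then there exists a vector x ∈ {0,1}^N such that for every K with 1 ≤ K ≤ min{M,N} and every K × K submatrix B of A (obtained by selecting K rows and K columns), E[‖𝒜(x) − Ax‖₂²] ≥ C · K · |det(B)|^{2/K} / (log₂ N)². -/
open MeasureTheory Finset
open scoped ENNReal NNReal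

noncomputable section

/-- `(ε,δ)`-differential privacy for a randomized algorithm mapping inputs in `[0,1]^N`
(ℓ₁-neighboring inputs differ by at most 1 in ℓ₁ norm) to probability measures on `Ω`. -/
def DiffPrivate {N : ℕ} {Ω : Type*} [MeasurableSpace Ω]
    (A : (Fin N → ℝ) → Measure Ω) (ε δ : ℝ) : Prop :=
  ∀ x x' : Fin N → ℝ,
    (∀ i, x i ∈ Set.Icc (0 : ℝ) 1) → (∀ i, x' i ∈ Set.Icc (0 : ℝ) 1) →
    (∑ i, |x i - x' i|) ≤ 1 →
    ∀ T : Set Ω, MeasurableSet T →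
      A x T ≤ ENNReal.ofReal (Real.exp ε) * A x' T + ENNReal.ofReal δ

lemma cb_aux {K : ℕ} {ι : Type} [Fintype ι] [DecidableEq ι] (X : Matrix ι (Fin K) ℂ) :
    (X.conjTranspose * X).det =
      ∑ f : Fin K → ι, (∏ i, star (X (f i) i)) * (X.submatrix f id).det := by
  have h1 : (X.conjTranspose * X) = (fun i => ∑ k, star (X k i) • X k : Matrix (Fin K) (Fin K) ℂ) := by
    ext i j
    simp [Matrix.mul_apply, Matrix.conjTranspose_apply, Finset.sum_apply]
  rw [h1]
  have := (Matrix.detRowAlternating (R := ℂ) (n := Fin K)).toMultilinearMap.map_sum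
    (fun i k => star (X k i) • X k)
  refine this.trans (Finset.sum_congr rfl fun f _ => ?_)
  exact (MultilinearMap.map_smul_univ _ (fun i => star (X (f i) i)) (fun i => X (f i)))

lemma cb {K : ℕ} {ι : Type} [Fintype ι] [DecidableEq ι] (X : Matrix ι (Fin K) ℂ) :
    (K.factorial : ℂ) * (X.conjTranspose * X).det =
      ((∑ f : Fin K → ι, ‖(X.submatrix f id).det‖ ^ 2 : ℝ) : ℂ) := by
  have h : ∀ σ : Equiv.Perm (Fin K), (X.conjTranspose * X).det =
      ∑ f : Fin K → ι, (∏ i, star (X (f (σ i)) i)) * (((σ.sign : ℤ) : ℂ) * (X.submatrix f id).det) := by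
    intro σ
    rw [cb_aux, ← (Equiv.arrowCongr σ.symm (Equiv.refl ι)).sum_comp]
    refine Finset.sum_congr rfl fun f _ => ?_
    congr 1
    have := Matrix.det_permute σ (X.submatrix f id)
    rw [← this]
    rfl
  have h2 : (K.factorial : ℂ) * (X.conjTranspose * X).det
      = ∑ σ : Equiv.Perm (Fin K), (X.conjTranspose * X).det := by
    simp [Fintype.card_perm]
  rw [h2, Finset.sum_congr rfl fun σ _ => h σ, Finset.sum_comm]
  push_cast
  refine Finset.sum_congr rfl fun f _ => ?_
  rw [← Complex.conj_mul', Matrix.det_apply', map_sum, Finset.sum_mul]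
  refine Finset.sum_congr rfl fun σ _ => ?_
  simp
  ring

lemma pow_bd {K J : ℕ} (hJ : 1 ≤ J) : ((K : ℝ) / J) ^ J ≤ 3 ^ K := by
  have hJ0 : (0:ℝ) < J := by exact_mod_cast hJ
  have h1 : (K : ℝ) / J ≤ Real.exp ((K : ℝ) / J) := by
    linarith [Real.add_one_le_exp ((K : ℝ) / J)]
  calc ((K : ℝ) / J) ^ J ≤ (Real.exp ((K : ℝ) / J)) ^ J := by gcongr
    _ = (Real.exp 1) ^ K := by
      rw [← Real.exp_nat_mul, ← Real.exp_nat_mul]; congr 1; field_simp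
    _ ≤ 3 ^ K := by
      have := Real.exp_one_lt_d9
      gcongr; linarith

lemma stack_bd {K : ℕ} (B : Matrix (Fin K) (Fin K) ℂ) (D : ℝ) (hD : 0 < D)
    (hB : ∀ J : ℕ, 1 ≤ J → ∀ r c : Fin J → Fin K, Function.Injective r → Function.Injective c →
      ‖(B.submatrix r c).det‖ ^ 2 ≤ ((K : ℝ) / J) ^ J * D ^ (2 * J))
    (f : Fin K → Fin K ⊕ Fin K) (hf : Function.Injective f) :
    ‖((Matrix.fromRows B ((D : ℂ) • (1 : Matrix (Fin K) (Fin K) ℂ))).submatrix f id).det‖ ^ 2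
      ≤ 3 ^ K * D ^ (2 * K) := by
  classical
  set X := (Matrix.fromRows B ((D : ℂ) • (1 : Matrix (Fin K) (Fin K) ℂ))).submatrix f id with hX
  let p : Fin K → Prop := fun i => (f i).isLeft
  have hl : ∀ i : {i // p i}, ∃ k, f i = Sum.inl k := fun i => Sum.isLeft_iff.1 i.2
  have hr : ∀ i : {i // ¬ p i}, ∃ k, f i = Sum.inr k := fun i => by
    have := i.2
    simp only [p, Sum.not_isLeft] at this
    exact Sum.isRight_iff.1 this
  choose l hl using hl
  choose g hg using hr
  have hli : Function.Injective l := fun a b h => Subtype.ext (hf (by rw [hl, hl, h]))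
  have hgi : Function.Injective g := fun a b h => Subtype.ext (hf (by rw [hg, hg, h]))
  obtain ⟨σ, hσ⟩ := Equiv.Perm.exists_extending_pair (fun i : {i // ¬ p i} => (i : Fin K)) g
    Subtype.val_injective hgi
  have hdet : ‖X.det‖ = ‖(X.submatrix id σ).det‖ := by
    rw [Matrix.det_permute']
    rcases Int.units_eq_one_or σ.sign with h | h <;> simp [h]
  have hrow : ∀ (i : {i // ¬ p i}) j, (X.submatrix id σ) i j = if (i : Fin K) = j then (D : ℂ) else 0 := by
    intro i j
    simp [hX, hg, Matrix.one_apply, ← hσ i]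
  have hb := Matrix.twoBlockTriangular_det (X.submatrix id σ) p (by
    intro i hi j hj
    rw [hrow ⟨i, hi⟩ j, if_neg]
    rintro rfl
    exact hi hj)
  have h2 : (Matrix.toSquareBlockProp (X.submatrix id σ) fun i => ¬ p i) = (D : ℂ) • 1 := by
    ext i j
    have := hrow i j
    simp only [Matrix.toSquareBlockProp_def, Matrix.of_apply]
    rw [this]
    simp [Matrix.one_apply, Subtype.ext_iff]
  set J := Fintype.card {i // p i} with hJ
  have hcard : Fintype.card {i // ¬ p i} = K - J := by
    rw [Fintype.card_subtype_compl, Fintype.card_fin]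
  have hJK : J ≤ K := by
    have := Fintype.card_subtype_le p
    simpa using this
  let e : Fin J ≃ {i // p i} := (Fintype.equivFin _).symm
  have h1 : (Matrix.toSquareBlockProp (X.submatrix id σ) p).det =
      (B.submatrix (fun k => l (e k)) (fun k => σ (e k))).det := by
    rw [← Matrix.det_submatrix_equiv_self e]
    congr 1
    ext a b
    simp [Matrix.toSquareBlockProp_def, hX, hl]
  have hminor : ‖(Matrix.toSquareBlockProp (X.submatrix id σ) p).det‖ ^ 2 ≤ 3 ^ K * D ^ (2 * J) := by
    rw [h1]
    rcases Nat.eq_zero_or_pos J with h0 | h0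
    · have : IsEmpty (Fin J) := by rw [h0]; infer_instance
      rw [Matrix.det_isEmpty, h0]
      simp
      exact one_le_pow₀ (by norm_num)
    · refine (hB J h0 _ _ (hli.comp e.injective)
        (σ.injective.comp (Subtype.val_injective.comp e.injective))).trans ?_
      gcongr
      exact pow_bd h0
  rw [hdet, hb, h2, Matrix.det_smul, Matrix.det_one, hcard, norm_mul, mul_pow]
  simp only [mul_one, norm_pow, Complex.norm_real, Real.norm_eq_abs, abs_of_pos hD]
  calc _ ≤ 3 ^ K * D ^ (2 * J) * (D ^ (K - J)) ^ 2 := by gcongr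
    _ = 3 ^ K * D ^ (2 * K) := by
      rw [← pow_mul, mul_assoc, ← pow_add]; congr 2; omega

lemma stack_det {K : ℕ} (B : Matrix (Fin K) (Fin K) ℂ) (D : ℝ) (hD : 0 < D)
    (hB : ∀ J : ℕ, 1 ≤ J → ∀ r c : Fin J → Fin K, Function.Injective r → Function.Injective c →
      ‖(B.submatrix r c).det‖ ^ 2 ≤ ((K : ℝ) / J) ^ J * D ^ (2 * J)) :
    ‖(B.conjTranspose * B + ((D ^ 2 : ℝ) : ℂ) • 1).det‖ ≤ 12 ^ K * D ^ (2 * K) := by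
  classical
  set X := (Matrix.fromRows B ((D : ℂ) • (1 : Matrix (Fin K) (Fin K) ℂ))) with hX
  have hXX : X.conjTranspose * X = B.conjTranspose * B + ((D ^ 2 : ℝ) : ℂ) • 1 := by
    rw [hX, Matrix.conjTranspose_fromRows_eq_fromCols_conjTranspose, Matrix.fromCols_mul_fromRows]
    congr 1
    ext i j
    simp [Matrix.conjTranspose_smul, pow_two]
    try ring
  rw [← hXX]
  have h := cb X
  have h' : (K.factorial : ℝ) * ‖(X.conjTranspose * X).det‖ =
      ∑ f : Fin K → Fin K ⊕ Fin K, ‖(X.submatrix f id).det‖ ^ 2 := by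
    have := congrArg norm h
    rw [norm_mul, Complex.norm_real, Complex.norm_natCast, Real.norm_eq_abs,
      abs_of_nonneg (by positivity)] at this
    exact this
  have hs : ∑ f : Fin K → Fin K ⊕ Fin K, ‖(X.submatrix f id).det‖ ^ 2 ≤
      ∑ f : Fin K → Fin K ⊕ Fin K with Function.Injective f, 3 ^ K * D ^ (2 * K) := by
    rw [← Finset.sum_filter_add_sum_filter_not univ (fun f : Fin K → Fin K ⊕ Fin K => Function.Injective f)]
    rw [Finset.sum_eq_zero (s := filter (fun f : Fin K → Fin K ⊕ Fin K => ¬ Function.Injective f) univ), add_zero]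
    · refine Finset.sum_le_sum fun f hf => ?_
      exact stack_bd B D hD hB f (by simpa using hf)
    · intro f hf
      have : ¬ Function.Injective f := by simpa using hf
      simp only [Function.Injective] at this
      push Not at this
      obtain ⟨i, j, hij, hne⟩ := this
      rw [Matrix.det_zero_of_row_eq hne (by ext k; simp [hij])]
      simp
  have hc : #{f : Fin K → Fin K ⊕ Fin K | Function.Injective f} = K.factorial * (K + K).choose K := by
    rw [← Fintype.card_subtype, Fintype.card_congr (Equiv.subtypeInjectiveEquivEmbedding _ _),
      Fintype.card_embedding_eq]
    simp [Nat.descFactorial_eq_factorial_mul_choose]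
  rw [Finset.sum_const, hc, nsmul_eq_mul, ← h'] at hs
  push_cast at hs
  rw [mul_assoc] at hs
  have hs2 := le_of_mul_le_mul_left hs (by positivity)
  refine hs2.trans ?_
  have : ((K + K).choose K : ℝ) ≤ 4 ^ K := by
    have := Nat.choose_le_two_pow (K + K) K
    calc ((K + K).choose K : ℝ) ≤ ((2 ^ (K + K) : ℕ) : ℝ) := by exact_mod_cast this
      _ = 4 ^ K := by push_cast; rw [← two_mul, pow_mul]; norm_num
  calc _ ≤ 4 ^ K * (3 ^ K * D ^ (2 * K)) := by gcongr
    _ = _ := by rw [← mul_assoc, ← mul_pow]; norm_num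

lemma nsq {n : Type} [Fintype n] (v : n → ℂ) : ((∑ k, ‖v k‖ ^ 2 : ℝ) : ℂ) = star v ⬝ᵥ v := by
  push_cast
  refine Finset.sum_congr rfl fun k _ => ?_
  rw [← Complex.conj_mul']; rfl

lemma nsq_mul {n : Type} [Fintype n] (M : Matrix n n ℂ) (v : n → ℂ) :
    ((∑ k, ‖(M.mulVec v) k‖ ^ 2 : ℝ) : ℂ) = star v ⬝ᵥ ((M.conjTranspose * M).mulVec v) := by
  rw [nsq, Matrix.star_mulVec, ← Matrix.dotProduct_mulVec, Matrix.mulVec_mulVec]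

lemma frob {n : Type} [Fintype n] (M : Matrix n n ℂ) :
    ((∑ k, ∑ l, ‖M k l‖ ^ 2 : ℝ) : ℂ) = (M.conjTranspose * M).trace := by
  rw [Finset.sum_comm]
  push_cast
  simp only [Matrix.trace, Matrix.diag, Matrix.mul_apply, Matrix.conjTranspose_apply]
  refine Finset.sum_congr rfl fun k _ => Finset.sum_congr rfl fun l _ => ?_
  rw [← Complex.conj_mul']; rfl

open scoped ComplexOrder in
lemma est {K : ℕ} (B : Matrix (Fin K) (Fin K) ℂ) (D a : ℝ) (hD : 0 < D) (ha : a = (12 ^ 16)⁻¹)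
    (hdet : ‖B.det‖ ^ 2 = D ^ (2 * K))
    (hB : ∀ J : ℕ, 1 ≤ J → ∀ r c : Fin J → Fin K, Function.Injective r → Function.Injective c →
      ‖(B.submatrix r c).det‖ ^ 2 ≤ ((K : ℝ) / J) ^ J * D ^ (2 * J)) :
    ∃ G : Matrix (Fin K) (Fin K) ℂ,
      (∀ w : Fin K → ℂ, (a * D ^ 2) * ∑ k, ‖(G.mulVec w) k‖ ^ 2 ≤ ∑ k, ‖w k‖ ^ 2) ∧
      16 * ∑ k, ∑ l, ‖(G * B - 1) k l‖ ^ 2 ≤ (K : ℝ) := by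
  classical
  have ha0 : 0 < a := by rw [ha]; positivity
  set H := B.conjTranspose * B with hH
  have hps : H.PosSemidef := Matrix.posSemidef_conjTranspose_mul_self B
  have hHm := hps.1
  let ev := hHm.eigenvalues
  have hev0 : ∀ i, 0 ≤ ev i := fun i => hps.eigenvalues_nonneg i
  obtain ⟨U, hUU, hUU', hspec⟩ : ∃ U : Matrix (Fin K) (Fin K) ℂ, U.conjTranspose * U = 1 ∧
      U * U.conjTranspose = 1 ∧
      H = U * Matrix.diagonal (fun i => (ev i : ℂ)) * U.conjTranspose := by
    refine ⟨hHm.eigenvectorUnitary, ?_, ?_, ?_⟩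
    · exact Unitary.coe_star_mul_self _
    · exact Unitary.coe_mul_star_self _
    · have := hHm.spectral_theorem
      rw [Unitary.conjStarAlgAut_apply] at this
      exact this
  have hdU : ∀ X : Matrix (Fin K) (Fin K) ℂ, (U * X * U.conjTranspose).det = X.det := by
    intro X
    rw [Matrix.det_mul, Matrix.det_mul, mul_right_comm, ← Matrix.det_mul, hUU', Matrix.det_one, one_mul]
  have hprod : ∏ i, ev i = D ^ (2 * K) := by
    rw [← hdet]
    have h1 : H.det = ((∏ i, ev i : ℝ) : ℂ) := by
      rw [hspec, hdU, Matrix.det_diagonal]; push_cast; rfl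
    have h2 : H.det = ((‖B.det‖ ^ 2 : ℝ) : ℂ) := by
      rw [hH, Matrix.det_mul, Matrix.det_conjTranspose]
      push_cast
      rw [← Complex.conj_mul']; rfl
    rw [h1] at h2
    exact_mod_cast h2
  have hprod2 : ∏ i, (ev i + D ^ 2) ≤ 12 ^ K * D ^ (2 * K) := by
    refine le_trans (le_of_eq ?_) (stack_det B D hD hB)
    have : B.conjTranspose * B + ((D ^ 2 : ℝ) : ℂ) • 1 =
        U * Matrix.diagonal (fun i => ((ev i + D ^ 2 : ℝ) : ℂ)) * U.conjTranspose := by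
      have h3 : Matrix.diagonal (fun i => ((ev i + D ^ 2 : ℝ) : ℂ)) =
          Matrix.diagonal (fun i => (ev i : ℂ)) + ((D ^ 2 : ℝ) : ℂ) • 1 := by
        ext i j
        by_cases hij : i = j
        · subst hij; simp
        · simp [hij]
      rw [h3, mul_add, add_mul, ← hspec, ← hH]
      simp only [Matrix.mul_smul, Matrix.smul_mul, mul_one, hUU']
    rw [this, hdU, Matrix.det_diagonal, ← Complex.ofReal_prod, Complex.norm_real, Real.norm_eq_abs,
      abs_of_nonneg]
    exact Finset.prod_nonneg fun i _ => add_nonneg (hev0 i) (by positivity)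
  let S : Finset (Fin K) := univ.filter fun i => ev i < a * D ^ 2
  have hScard : 16 * #S ≤ K := by
    have hlow : (12 ^ 16 : ℝ) ^ #S * ∏ i, ev i ≤ ∏ i, (ev i + D ^ 2) := by
      have : (12 ^ 16 : ℝ) ^ #S = ∏ i, if i ∈ S then (12 ^ 16 : ℝ) else 1 := by
        rw [Finset.prod_ite_mem]; simp
      rw [this, ← Finset.prod_mul_distrib]
      refine Finset.prod_le_prod (fun i _ => mul_nonneg (by split_ifs <;> norm_num) (hev0 i)) fun i _ => ?_
      split_ifs with hi
      · have h1 : ev i < a * D ^ 2 := by simpa [S] using hi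
        have h2 : 12 ^ 16 * (a * D ^ 2) = D ^ 2 := by rw [ha]; field_simp
        have := hev0 i
        nlinarith
      · have : 0 ≤ D ^ 2 := by positivity
        linarith
    rw [hprod] at hlow
    have h4 : (12 ^ 16 : ℝ) ^ #S ≤ 12 ^ K :=
      le_of_mul_le_mul_right (hlow.trans hprod2) (by positivity)
    rw [← pow_mul] at h4
    exact (pow_le_pow_iff_right₀ (by norm_num : (1:ℝ) < 12)).1 h4
  have hdB : IsUnit B.det := by
    rw [isUnit_iff_ne_zero]
    intro h0
    rw [h0] at hdet
    have : 0 < D ^ (2 * K) := by positivity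
    have hK0 : ‖(0:ℂ)‖ ^ 2 = 0 := by simp
    linarith
  let E : Matrix (Fin K) (Fin K) ℂ := Matrix.diagonal fun i => if i ∈ S then 0 else 1
  let F : Matrix (Fin K) (Fin K) ℂ := Matrix.diagonal fun i => if i ∈ S then 1 else 0
  have hEF : E + F = 1 := by
    rw [Matrix.diagonal_add, ← Matrix.diagonal_one]
    congr 1
    ext i
    split_ifs <;> simp
  refine ⟨U * E * U.conjTranspose * B⁻¹, ?_, ?_⟩
  · intro w
    set v := B⁻¹.mulVec w with hv
    have hw : w = B.mulVec v := by
      rw [hv, Matrix.mulVec_mulVec, Matrix.mul_nonsing_inv _ hdB, Matrix.one_mulVec]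
    set q := U.conjTranspose.mulVec v with hq
    have e1 : ∑ k, ‖((U * E * U.conjTranspose * B⁻¹).mulVec w) k‖ ^ 2 =
        ∑ k, ‖(if k ∈ S then 0 else 1) * q k‖ ^ 2 := by
      have : (U * E * U.conjTranspose * B⁻¹).mulVec w = U.mulVec (E.mulVec q) := by
        simp [hq, hv, Matrix.mulVec_mulVec, Matrix.mul_assoc]
      rw [this]
      have h5 := nsq_mul U (E.mulVec q)
      rw [hUU, Matrix.one_mulVec, ← nsq] at h5
      have h6 := Complex.ofReal_injective h5
      rw [h6]
      simp only [E, Matrix.mulVec_diagonal]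
    have e2 : ∑ k, ‖w k‖ ^ 2 = ∑ k, ev k * ‖q k‖ ^ 2 := by
      have h5 := nsq_mul B v
      rw [← hw, ← hH, hspec, ← Matrix.mulVec_mulVec, ← hq, ← Matrix.mulVec_mulVec,
        Matrix.dotProduct_mulVec] at h5
      have h7 : star q = Matrix.vecMul (star v) U := by
        rw [hq, Matrix.star_mulVec, Matrix.conjTranspose_conjTranspose]
      rw [← h7] at h5
      have h8 : (star q ⬝ᵥ (Matrix.diagonal fun i => (ev i : ℂ)).mulVec q) =
          ((∑ k, ev k * ‖q k‖ ^ 2 : ℝ) : ℂ) := by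
        push_cast
        refine Finset.sum_congr rfl fun k _ => ?_
        rw [Matrix.mulVec_diagonal, ← Complex.conj_mul']
        simp only [Pi.star_apply, RCLike.star_def]
        ring
      rw [h8] at h5
      exact Complex.ofReal_injective h5
    rw [e1, e2, Finset.mul_sum]
    refine Finset.sum_le_sum fun k _ => ?_
    split_ifs with hk
    · simp
      exact mul_nonneg (hev0 k) (by positivity)
    · have : a * D ^ 2 ≤ ev k := by simpa [S] using hk
      rw [one_mul]
      gcongr
  · have e1 : U * E * U.conjTranspose * B⁻¹ * B - 1 = -(U * F * U.conjTranspose) := by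
      rw [Matrix.mul_assoc _ B⁻¹ B, Matrix.nonsing_inv_mul _ hdB, mul_one,
        eq_sub_of_add_eq hEF, mul_sub, sub_mul, mul_one, hUU']
      abel
    have e2 : ∑ k, ∑ l, ‖(U * E * U.conjTranspose * B⁻¹ * B - 1) k l‖ ^ 2 = (#S : ℝ) := by
      apply Complex.ofReal_injective
      rw [frob, e1]
      have hF : F.conjTranspose = F := by
        simp only [F, Matrix.diagonal_conjTranspose]
        congr 1; ext i; simp; 
      have hFF : F * F = F := by
        simp only [F, Matrix.diagonal_mul_diagonal]
        congr 1; ext i; simp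
      have : (-(U * F * U.conjTranspose)).conjTranspose * (-(U * F * U.conjTranspose)) =
          U * F * U.conjTranspose := by
        rw [Matrix.conjTranspose_neg, neg_mul_neg, Matrix.conjTranspose_mul, Matrix.conjTranspose_mul,
          Matrix.conjTranspose_conjTranspose, hF]
        calc _ = U * F * (U.conjTranspose * U) * F * U.conjTranspose := by simp only [Matrix.mul_assoc]
          _ = U * (F * F) * U.conjTranspose := by rw [hUU]; simp only [mul_one, Matrix.mul_assoc]
          _ = _ := by rw [hFF]
      rw [this, Matrix.trace_mul_comm, ← Matrix.mul_assoc, hUU, one_mul]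
      simp [F, Matrix.trace]
    rw [e2]
    exact_mod_cast hScard

lemma dp_pair {Ω : Type*} [MeasurableSpace Ω] (μ ν : Measure Ω) [IsProbabilityMeasure μ]
    [IsProbabilityMeasure ν] (ε δ : ℝ) (hε : ε ≤ 1 / 4) (hδ0 : 0 < δ) (hδ : δ ≤ 1 / 4)
    (h : ∀ T : Set Ω, MeasurableSet T →
      μ T ≤ ENNReal.ofReal (Real.exp ε) * ν T + ENNReal.ofReal δ)
    (g : Ω → ℝ) (hg : Measurable g) :
    ENNReal.ofReal (1 / 8) ≤ ∫⁻ y, ENNReal.ofReal ((g y - (-1 / 2)) ^ 2) ∂μ +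
      ∫⁻ y, ENNReal.ofReal ((g y - 1 / 2) ^ 2) ∂ν := by
  set T : Set Ω := {y | g y ≤ 0} with hT
  have hTm : MeasurableSet T := measurableSet_le hg measurable_const
  have h1 : ENNReal.ofReal (1 / 4) * μ Tᶜ ≤ ∫⁻ y, ENNReal.ofReal ((g y - (-1 / 2)) ^ 2) ∂μ := by
    rw [← setLIntegral_const]
    refine (setLIntegral_mono' hTm.compl fun y hy => ?_).trans (setLIntegral_le_lintegral _ _)
    apply ENNReal.ofReal_le_ofReal
    have : 0 < g y := by simpa [hT] using hy
    nlinarith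
  have h2 : ENNReal.ofReal (1 / 4) * ν T ≤ ∫⁻ y, ENNReal.ofReal ((g y - 1 / 2) ^ 2) ∂ν := by
    rw [← setLIntegral_const]
    refine (setLIntegral_mono' hTm fun y hy => ?_).trans (setLIntegral_le_lintegral _ _)
    apply ENNReal.ofReal_le_ofReal
    have : g y ≤ 0 := hy
    nlinarith
  refine le_trans ?_ (add_le_add h1 h2)
  have h3 := h T hTm
  have m1 : μ T = ENNReal.ofReal (μ.real T) := by simp
  have m2 : ν T = ENNReal.ofReal (ν.real T) := by simp
  have m3 : μ Tᶜ = ENNReal.ofReal (1 - μ.real T) := by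
    rw [← probReal_compl_eq_one_sub hTm]; simp
  have n0 : 0 ≤ ν.real T := measureReal_nonneg
  have m0 : 0 ≤ μ.real T := measureReal_nonneg
  have m01 : μ.real T ≤ 1 := measureReal_le_one
  rw [m1, m2, ← ENNReal.ofReal_mul (by positivity), ← ENNReal.ofReal_add (by positivity) hδ0.le,
    ENNReal.ofReal_le_ofReal_iff (by positivity)] at h3
  rw [m2, m3, ← ENNReal.ofReal_mul (by positivity), ← ENNReal.ofReal_mul (by positivity),
    ← ENNReal.ofReal_add (by nlinarith) (by positivity)]
  apply ENNReal.ofReal_le_ofReal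
  have he : Real.exp ε ≤ 4 / 3 := by
    have h5 := Real.add_one_le_exp (-ε)
    rw [Real.exp_neg] at h5
    have h6 : (3 / 4 : ℝ) ≤ (Real.exp ε)⁻¹ := by linarith
    have h7 := inv_anti₀ (by norm_num) h6
    rw [inv_inv] at h7
    linarith
  have h8 : Real.exp ε * ν.real T ≤ 4 / 3 * ν.real T := by gcongr
  linarith

/-- sign value -/
def zz (b : Bool) : ℝ := if b then 1 / 2 else -1 / 2

/-- flip one coordinate -/
def flip1 {K : ℕ} (k : Fin K) : Equiv.Perm (Fin K → Bool) :=
  Function.Involutive.toPerm (fun s => Function.update s k (!s k)) (by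
    intro s; simp)

lemma flip1_same {K : ℕ} (k : Fin K) (s : Fin K → Bool) : flip1 k s k = !s k := by
  change Function.update s k (!s k) k = _
  simp

lemma flip1_ne {K : ℕ} (k l : Fin K) (h : l ≠ k) (s : Fin K → Bool) : flip1 k s l = s l := by
  change Function.update s k (!s k) l = _
  simp [h]

lemma zz_orth {K : ℕ} (k l : Fin K) :
    ∑ s : Fin K → Bool, zz (s k) * zz (s l) = if k = l then (2 : ℝ) ^ K / 4 else 0 := by
  split_ifs with h
  · subst h
    have : ∀ s : Fin K → Bool, zz (s k) * zz (s k) = 1 / 4 := by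
      intro s; unfold zz; split_ifs <;> norm_num
    simp [this]
    ring
  · have h1 : ∑ s : Fin K → Bool, zz (s k) * zz (s l) =
        ∑ s : Fin K → Bool, -(zz (s k) * zz (s l)) := by
      rw [← Equiv.sum_comp (flip1 k)]
      refine Finset.sum_congr rfl fun s _ => ?_
      rw [flip1_same, flip1_ne k l (Ne.symm h)]
      unfold zz
      cases s k <;> cases s l <;> norm_num
    rw [Finset.sum_neg_distrib] at h1
    linarith

lemma avg {K : ℕ} (m : Fin K → ℂ) :
    ∑ s : Fin K → Bool, ‖∑ l, m l * (zz (s l) : ℂ)‖ ^ 2 = 2 ^ K / 4 * ∑ l, ‖m l‖ ^ 2 := by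
  apply Complex.ofReal_injective
  push_cast
  have h : ∀ s : Fin K → Bool, ((‖∑ l, m l * (zz (s l) : ℂ)‖ : ℂ)) ^ 2 =
      ∑ k, ∑ l, (starRingEnd ℂ (m k) * m l) * ((zz (s k) * zz (s l) : ℝ) : ℂ) := by
    intro s
    rw [← Complex.conj_mul', map_sum, Finset.sum_mul_sum]
    refine Finset.sum_congr rfl fun k _ => Finset.sum_congr rfl fun l _ => ?_
    simp
    ring
  rw [Finset.sum_congr rfl fun s _ => h s, Finset.sum_comm, Finset.mul_sum]
  refine Finset.sum_congr rfl fun k _ => ?_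
  rw [Finset.sum_comm]
  simp_rw [← Finset.mul_sum, ← Complex.ofReal_sum, zz_orth]
  rw [Finset.sum_eq_single k]
  · rw [← Complex.conj_mul']; simp; ring
  · intro l _ hl
    simp [Ne.symm hl]
  · simp

/-- cube point supported on the selected columns -/
def xs {N K : ℕ} (c : Fin K → Fin N) (s : Fin K → Bool) : Fin N → ℝ :=
  fun n => ∑ k, if c k = n then zz (s k) + 1 / 2 else 0

lemma xs_c {N K : ℕ} (c : Fin K → Fin N) (hc : Function.Injective c) (s : Fin K → Bool) (k : Fin K) :
    xs c s (c k) = zz (s k) + 1 / 2 := by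
  unfold xs
  simp [hc.eq_iff]

lemma xs_01 {N K : ℕ} (c : Fin K → Fin N) (hc : Function.Injective c) (s : Fin K → Bool) (n : Fin N) :
    xs c s n = 0 ∨ xs c s n = 1 := by
  by_cases h : ∃ k, c k = n
  · obtain ⟨k, rfl⟩ := h
    rw [xs_c c hc]
    unfold zz
    cases s k <;> norm_num
  · left
    unfold xs
    push Not at h
    simp [h]

lemma xs_mulVec {M N K : ℕ} (A : Matrix (Fin M) (Fin N) ℂ) (c : Fin K → Fin N) (r : Fin K → Fin M)
    (s : Fin K → Bool) (i : Fin K) :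
    A.mulVec (fun n => ((xs c s n : ℝ) : ℂ)) (r i) =
      (A.submatrix r c).mulVec (fun k => ((zz (s k) : ℂ) + 1 / 2)) i := by
  simp only [Matrix.mulVec, dotProduct, xs, Matrix.submatrix_apply]
  push_cast
  simp_rw [Finset.mul_sum]
  rw [Finset.sum_comm]
  refine Finset.sum_congr rfl fun k _ => ?_
  rw [Finset.sum_eq_single (c k)]
  · simp
  · intro n _ hn
    simp [Ne.symm hn]
  · simp

lemma xs_dist {N K : ℕ} (c : Fin K → Fin N) (s t : Fin K → Bool) (k : Fin K)
    (h : ∀ l, l ≠ k → s l = t l) : ∑ n, |xs c s n - xs c t n| ≤ 1 := by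
  have h1 : ∀ n, xs c s n - xs c t n = if c k = n then zz (s k) - zz (t k) else 0 := by
    intro n
    unfold xs
    rw [← Finset.sum_sub_distrib, Finset.sum_eq_single k]
    · split_ifs <;> ring
    · intro l _ hl
      rw [h l hl]; simp
    · simp
  simp_rw [h1]
  rw [Finset.sum_eq_single (c k)]
  · simp
    unfold zz
    cases s k <;> cases t k <;> norm_num
  · intro n _ hn
    simp [Ne.symm hn]
  · simp

lemma coord {Ω : Type*} [MeasurableSpace Ω] {N K : ℕ}
    (𝒜 : (Fin N → ℝ) → Measure Ω) (hP : ∀ x, IsProbabilityMeasure (𝒜 x))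
    (ε δ : ℝ) (hε : ε ≤ 1 / 4) (hδ0 : 0 < δ) (hδ : δ ≤ 1 / 4) (hdp : DiffPrivate 𝒜 ε δ)
    (c : Fin K → Fin N) (hc : Function.Injective c) (k : Fin K) (g : Ω → ℝ) (hg : Measurable g) :
    ENNReal.ofReal (2 ^ K / 16) ≤
      ∑ s : Fin K → Bool, ∫⁻ y, ENNReal.ofReal ((g y - zz (s k)) ^ 2) ∂(𝒜 (xs c s)) := by
  set φ : (Fin K → Bool) → ℝ≥0∞ :=
    fun s => ∫⁻ y, ENNReal.ofReal ((g y - zz (s k)) ^ 2) ∂(𝒜 (xs c s)) with hφ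
  have h01 : ∀ s n, xs c s n ∈ Set.Icc (0:ℝ) 1 := by
    intro s n
    rcases xs_01 c hc s n with h | h <;> rw [h] <;> simp
  have hkey : ∀ s t : Fin K → Bool, (∀ l, l ≠ k → s l = t l) → s k = false → t k = true →
      ENNReal.ofReal (1 / 8) ≤ φ s + φ t := by
    intro s t hst hs ht
    have := dp_pair (𝒜 (xs c s)) (𝒜 (xs c t)) ε δ hε hδ0 hδ
      (hdp _ _ (h01 s) (h01 t) (xs_dist c s t k hst)) g hg
    simpa [hφ, hs, ht, zz] using this
  have hpair : ∀ s, ENNReal.ofReal (1 / 8) ≤ φ s + φ (flip1 k s) := by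
    intro s
    cases hs : s k
    · exact hkey s _ (fun l hl => (flip1_ne k l hl s).symm) hs (by rw [flip1_same, hs]; rfl)
    · rw [add_comm]
      exact hkey _ s (fun l hl => (flip1_ne k l hl s)) (by rw [flip1_same, hs]; rfl) hs
  have hsum : ∑ s : Fin K → Bool, ENNReal.ofReal (1 / 8) ≤ 2 * ∑ s, φ s := by
    refine (Finset.sum_le_sum fun s _ => hpair s).trans ?_
    rw [Finset.sum_add_distrib, Equiv.sum_comp (flip1 k), two_mul]
  have e1 : ∑ s : Fin K → Bool, ENNReal.ofReal (1 / 8) = 2 * ENNReal.ofReal (2 ^ K / 16) := by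
    rw [Finset.sum_const, nsmul_eq_mul, ← ENNReal.ofReal_natCast, ← ENNReal.ofReal_mul (by positivity)]
    rw [show (2 : ℝ≥0∞) = ENNReal.ofReal 2 by simp, ← ENNReal.ofReal_mul (by positivity)]
    congr 1
    simp
    ring
  rw [e1] at hsum
  exact (ENNReal.mul_le_mul_iff_right (by simp) (by simp)).1 hsum

lemma ptwise {K : ℕ} (B G : Matrix (Fin K) (Fin K) ℂ) (L : ℝ) (hL : 0 < L)
    (hG : ∀ w : Fin K → ℂ, L * ∑ k, ‖(G.mulVec w) k‖ ^ 2 ≤ ∑ k, ‖w k‖ ^ 2)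
    (y : Fin K → ℂ) (s : Fin K → Bool) :
    ∑ k, ((G.mulVec (y - B.mulVec (fun _ => 1 / 2)) k).re - zz (s k)) ^ 2 ≤
      2 / L * ∑ k, ‖y k - B.mulVec (fun k => ((zz (s k) : ℂ) + 1 / 2)) k‖ ^ 2 +
      2 * ∑ k, ‖∑ l, (G * B - 1) k l * (zz (s l) : ℂ)‖ ^ 2 := by
  set z : Fin K → ℂ := fun k => (zz (s k) : ℂ) with hz
  set w : Fin K → ℂ := fun k => y k - B.mulVec (fun k => z k + 1 / 2) k with hw
  have hdec : ∀ k, G.mulVec (y - B.mulVec (fun _ => 1 / 2)) k - z k =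
      G.mulVec w k + ((G * B - 1).mulVec z) k := by
    have h1 : w = (y - B.mulVec (fun _ => 1 / 2)) - B.mulVec z := by
      have : (fun k => z k + 1 / 2) = z + (fun _ : Fin K => (1 / 2 : ℂ)) := rfl
      ext k
      simp only [hw, this, Matrix.mulVec_add, Pi.sub_apply, Pi.add_apply]
      ring
    intro k
    rw [h1, Matrix.mulVec_sub G _ (B.mulVec z), Matrix.sub_mulVec, Matrix.mulVec_mulVec z,
      Matrix.one_mulVec]
    simp only [Pi.sub_apply]
    ring
  have hk : ∀ k, ((G.mulVec (y - B.mulVec (fun _ => 1 / 2)) k).re - zz (s k)) ^ 2 ≤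
      2 * ‖G.mulVec w k‖ ^ 2 + 2 * ‖((G * B - 1).mulVec z) k‖ ^ 2 := by
    intro k
    have h2 : (G.mulVec (y - B.mulVec (fun _ => 1 / 2)) k).re - zz (s k) =
        (G.mulVec (y - B.mulVec (fun _ => 1 / 2)) k - z k).re := by simp [hz]
    rw [h2, hdec k]
    have h3 := Complex.abs_re_le_norm (G.mulVec w k + ((G * B - 1).mulVec z) k)
    have h4 := norm_add_le (G.mulVec w k) (((G * B - 1).mulVec z) k)
    have h5 := sq_le_sq' (by linarith [abs_nonneg (G.mulVec w k + ((G * B - 1).mulVec z) k).re, norm_nonneg (G.mulVec w k), norm_nonneg (((G * B - 1).mulVec z) k)]) (h3.trans h4)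
    rw [sq_abs] at h5
    nlinarith [sq_nonneg (‖G.mulVec w k‖ - ‖((G * B - 1).mulVec z) k‖)]
  refine (Finset.sum_le_sum fun k _ => hk k).trans ?_
  rw [Finset.sum_add_distrib, ← Finset.mul_sum, ← Finset.mul_sum]
  refine add_le_add ?_ (le_of_eq rfl)
  have := hG w
  rw [div_mul_eq_mul_div, le_div_iff₀ hL]
  nlinarith

lemma dp_main {M N K : ℕ} (hK : 1 ≤ K) (A : Matrix (Fin M) (Fin N) ℂ)
    (𝒜 : (Fin N → ℝ) → Measure (Fin M → ℂ)) (hP : ∀ x, IsProbabilityMeasure (𝒜 x))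
    (ε δ : ℝ) (hε : ε ≤ 1 / 4) (hδ0 : 0 < δ) (hδ : δ ≤ 1 / 4) (hdp : DiffPrivate 𝒜 ε δ)
    (r : Fin K → Fin M) (c : Fin K → Fin N) (hr : Function.Injective r) (hc : Function.Injective c)
    (G : Matrix (Fin K) (Fin K) ℂ) (L : ℝ) (hL : 0 < L)
    (hG : ∀ w : Fin K → ℂ, L * ∑ k, ‖(G.mulVec w) k‖ ^ 2 ≤ ∑ k, ‖w k‖ ^ 2)
    (hGB : 16 * ∑ k, ∑ l, ‖(G * A.submatrix r c - 1) k l‖ ^ 2 ≤ (K : ℝ)) :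
    ∃ s : Fin K → Bool, ENNReal.ofReal (L * K / 64) ≤
      ∫⁻ y, ∑ i, (‖y i - A.mulVec (fun n => ((xs c s n : ℝ) : ℂ)) i‖₊ : ℝ≥0∞) ^ 2 ∂(𝒜 (xs c s)) := by
  set B := A.submatrix r c with hB
  set e : (Fin K → Bool) → ℝ≥0∞ := fun s =>
    ∫⁻ y, ∑ i, (‖y i - A.mulVec (fun n => ((xs c s n : ℝ) : ℂ)) i‖₊ : ℝ≥0∞) ^ 2 ∂(𝒜 (xs c s)) with he
  set R : (Fin K → Bool) → ℝ := fun s => ∑ k, ‖∑ l, (G * B - 1) k l * (zz (s l) : ℂ)‖ ^ 2 with hR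
  have hR0 : ∀ s, 0 ≤ R s := fun s => by positivity
  set g : Fin K → (Fin M → ℂ) → ℝ := fun k y =>
    (G.mulVec ((fun i => y (r i)) - B.mulVec (fun _ => 1 / 2)) k).re with hg
  have hgm : ∀ k, Measurable (g k) := by
    intro k
    simp only [hg, Matrix.mulVec, dotProduct, Pi.sub_apply]
    fun_prop
  have hup : ∀ s, ∑ k, ∫⁻ y, ENNReal.ofReal ((g k y - zz (s k)) ^ 2) ∂(𝒜 (xs c s)) ≤
      ENNReal.ofReal (2 / L) * e s + ENNReal.ofReal (2 * R s) := by
    intro s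
    rw [← lintegral_finsetSum _ (fun k _ => by have := hgm k; fun_prop)]
    rw [he, ← lintegral_const_mul _ (by fun_prop)]
    have : ENNReal.ofReal (2 * R s) = ∫⁻ y, ENNReal.ofReal (2 * R s) ∂(𝒜 (xs c s)) := by simp
    rw [this, ← lintegral_add_right _ measurable_const]
    refine lintegral_mono fun y => ?_
    have e1 : ∑ i, (‖y i - A.mulVec (fun n => ((xs c s n : ℝ) : ℂ)) i‖₊ : ℝ≥0∞) ^ 2 =
        ENNReal.ofReal (∑ i, ‖y i - A.mulVec (fun n => ((xs c s n : ℝ) : ℂ)) i‖ ^ 2) := by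
      rw [ENNReal.ofReal_sum_of_nonneg (fun i _ => by positivity)]
      refine Finset.sum_congr rfl fun i _ => ?_
      rw [ENNReal.ofReal_pow (norm_nonneg _), ofReal_norm, enorm_eq_nnnorm]
    simp only
    rw [e1, ← ENNReal.ofReal_mul (by positivity), ← ENNReal.ofReal_add (by positivity)
      (by have := hR0 s; positivity), ← ENNReal.ofReal_sum_of_nonneg (fun i _ => by positivity)]
    apply ENNReal.ofReal_le_ofReal
    refine (ptwise B G L hL hG (fun i => y (r i)) s).trans ?_
    gcongr
    simp only [hB, ← xs_mulVec]
    rw [← Finset.sum_image (s := univ) (g := r)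
      (f := fun i => ‖y i - A.mulVec (fun n => ((xs c s n : ℝ) : ℂ)) i‖ ^ 2) (fun a _ b _ h => hr h)]
    exact Finset.sum_le_sum_of_subset_of_nonneg (Finset.subset_univ _) (fun i _ _ => by positivity)
  have hRs : ∑ s, R s ≤ 2 ^ K * K / 64 := by
    rw [hR, Finset.sum_comm]
    simp_rw [avg]
    rw [← Finset.mul_sum]
    have : (0:ℝ) < 2 ^ K := by positivity
    nlinarith
  have hlow : ENNReal.ofReal (K * (2 ^ K / 16)) ≤
      ∑ s, ∑ k, ∫⁻ y, ENNReal.ofReal ((g k y - zz (s k)) ^ 2) ∂(𝒜 (xs c s)) := by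
    rw [Finset.sum_comm]
    refine le_trans (le_of_eq ?_) (Finset.sum_le_sum fun k _ =>
      coord 𝒜 hP ε δ hε hδ0 hδ hdp c hc k (g k) (hgm k))
    rw [Finset.sum_const, nsmul_eq_mul, ENNReal.ofReal_mul (by positivity)]
    simp
  by_contra hcon
  push Not at hcon
  have hlt : ∀ s, e s < ENNReal.ofReal (L * K / 64) := hcon
  have her : ∀ s, e s = ENNReal.ofReal (e s).toReal := fun s =>
    (ENNReal.ofReal_toReal (hlt s).ne_top).symm
  have hel : ∀ s, (e s).toReal < L * K / 64 := fun s => by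
    have := hlt s
    rw [her s] at this
    exact (ENNReal.ofReal_lt_ofReal_iff_of_nonneg ENNReal.toReal_nonneg).1 this
  have htot := hlow.trans (Finset.sum_le_sum fun s _ => hup s)
  have : ∑ s, (ENNReal.ofReal (2 / L) * e s + ENNReal.ofReal (2 * R s)) =
      ENNReal.ofReal (∑ s, (2 / L * (e s).toReal + 2 * R s)) := by
    rw [ENNReal.ofReal_sum_of_nonneg (fun s _ => by have := hR0 s; positivity)]
    refine Finset.sum_congr rfl fun s _ => ?_
    rw [ENNReal.ofReal_add (by positivity) (by have := hR0 s; positivity),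
      ENNReal.ofReal_mul (p := 2 / L) (by positivity), ← her s]
  rw [this, ENNReal.ofReal_le_ofReal_iff
    (Finset.sum_nonneg fun s _ => by have := hR0 s; positivity), Finset.sum_add_distrib,
    ← Finset.mul_sum, ← Finset.mul_sum] at htot
  have hes : ∑ s, (e s).toReal < 2 ^ K * (L * K / 64) := by
    have := Finset.sum_lt_sum_of_nonempty (s := (univ : Finset (Fin K → Bool))) univ_nonempty
      (fun s _ => hel s)
    simpa using this
  have h9 : 2 / L * ∑ s, (e s).toReal < 2 / L * (2 ^ K * (L * K / 64)) := by gcongr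
  have h10 : 2 / L * (2 ^ K * (L * K / 64)) = 2 ^ K * K / 32 := by field_simp; norm_num
  linarith

theorem det_lower_bound :
    ∃ C ε₀ δ₀ : ℝ, 0 < C ∧ 0 < ε₀ ∧ 0 < δ₀ ∧
      ∀ (M N : ℕ) (A : Matrix (Fin M) (Fin N) ℂ)
        (𝒜 : (Fin N → ℝ) → Measure (Fin M → ℂ)),
        (∀ x, IsProbabilityMeasure (𝒜 x)) →
        ∀ ε δ : ℝ, 0 < ε → ε ≤ ε₀ → 0 < δ → δ ≤ δ₀ →
        DiffPrivate 𝒜 ε δ →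
        ∃ x : Fin N → ℝ, (∀ i, x i = 0 ∨ x i = 1) ∧
          ∀ K : ℕ, 1 ≤ K → K ≤ min M N →
          ∀ (r : Fin K → Fin M) (c : Fin K → Fin N),
            Function.Injective r → Function.Injective c →
            ENNReal.ofReal (C * (K : ℝ) * ‖(A.submatrix r c).det‖ ^ ((2 : ℝ) / K) /
                (Real.logb 2 N) ^ 2) ≤
              ∫⁻ y, ∑ i, (‖y i - A.mulVec (fun n => ((x n : ℝ) : ℂ)) i‖₊ : ℝ≥0∞) ^ 2 ∂(𝒜 x) := by
  classical
  obtain ⟨a, ha⟩ : ∃ a : ℝ, a = (12 ^ 16)⁻¹ := ⟨_, rfl⟩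
  have ha0 : 0 < a := by rw [ha]; positivity
  refine ⟨a / 64, 1 / 4, 1 / 4, by positivity, by norm_num, by norm_num, ?_⟩
  intro M N A 𝒜 hP ε δ hε0 hε hδ0 hδ hdp
  -- maximal submatrix
  let T := Σ K : Fin (N + 1), (Fin K → Fin M) × (Fin K → Fin N)
  let val : T → ℝ := fun t =>
    ((t.1 : ℕ) : ℝ) * ‖(A.submatrix t.2.1 t.2.2).det‖ ^ ((2 : ℝ) / ((t.1 : ℕ) : ℝ))
  let F : Finset T := univ.filter fun t =>
    1 ≤ (t.1 : ℕ) ∧ Function.Injective t.2.1 ∧ Function.Injective t.2.2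
  -- it is enough to dominate all values by some V
  have hred : ∀ V : ℝ, 0 ≤ V → (∀ K : ℕ, 1 ≤ K → ∀ (r : Fin K → Fin M) (c : Fin K → Fin N),
      Function.Injective r → Function.Injective c →
      (K : ℝ) * ‖(A.submatrix r c).det‖ ^ ((2 : ℝ) / K) ≤ V) → ∀ K : ℕ, 1 ≤ K →
      ∀ (r : Fin K → Fin M) (c : Fin K → Fin N), Function.Injective r → Function.Injective c →
      a / 64 * (K : ℝ) * ‖(A.submatrix r c).det‖ ^ ((2 : ℝ) / K) / (Real.logb 2 N) ^ 2 ≤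
        a / 64 * V := by
    intro V hV0 hV K hK r c hr hc
    have h1 := hV K hK r c hr hc
    have hKN : K ≤ N := by simpa using Fintype.card_le_of_injective c hc
    rcases Nat.lt_or_ge N 2 with hN | hN
    · have : N = 1 := by omega
      have h0 : Real.logb 2 (N : ℝ) = 0 := by rw [this]; simp
      rw [h0]
      simp
      positivity
    · have hlog : 1 ≤ Real.logb 2 N := by
        rw [Real.le_logb_iff_rpow_le (by norm_num) (by positivity)]
        simpa using hN
      have hl2 : 1 ≤ (Real.logb 2 N) ^ 2 := one_le_pow₀ hlog
      refine (div_le_self (by positivity) hl2).trans ?_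
      rw [mul_assoc]
      gcongr
  by_cases hF : ∃ t ∈ F, 0 < val t
  · obtain ⟨t0, ht0, hpos0⟩ := hF
    obtain ⟨t, ht, hmax⟩ := Finset.exists_max_image F val ⟨t0, ht0⟩
    have hpos : 0 < val t := hpos0.trans_le (hmax t0 ht0)
    have hmax' : ∀ J : ℕ, 1 ≤ J → ∀ (r : Fin J → Fin M) (c : Fin J → Fin N),
      Function.Injective r → Function.Injective c →
      (J : ℝ) * ‖(A.submatrix r c).det‖ ^ ((2 : ℝ) / J) ≤ val t := by
      intro J hJ r c hr hc
      have hJN : J ≤ N := by simpa using Fintype.card_le_of_injective c hc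
      exact hmax ⟨⟨J, by omega⟩, (r, c)⟩ (by simp [F, hJ, hr, hc])
    obtain ⟨⟨K, hKN⟩, r, c⟩ := t
    simp only [F, Finset.mem_filter, Finset.mem_univ, true_and] at ht
    obtain ⟨hK, hr, hc⟩ := ht
    have hvdef : val ⟨⟨K, hKN⟩, (r, c)⟩ = (K : ℝ) * ‖(A.submatrix r c).det‖ ^ ((2 : ℝ) / K) := rfl
    rw [hvdef] at hpos hmax'
    simp only at r c hr hc hK
    have hK0 : (0:ℝ) < K := by exact_mod_cast hK
    set B := A.submatrix r c with hB
    have hBd : 0 < ‖B.det‖ := by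
      rcases (norm_nonneg B.det).lt_or_eq with h | h
      · exact h
      · rw [← h, Real.zero_rpow (by positivity)] at hpos
        simp at hpos
    set D := ‖B.det‖ ^ ((1 : ℝ) / K) with hDdef
    have hD : 0 < D := Real.rpow_pos_of_pos hBd _
    have hD2 : ‖B.det‖ ^ ((2 : ℝ) / K) = D ^ 2 := by
      rw [hDdef, ← Real.rpow_natCast, ← Real.rpow_mul hBd.le]
      congr 1; push_cast; ring
    have hDK : ‖B.det‖ = D ^ K := by
      rw [hDdef, ← Real.rpow_natCast, ← Real.rpow_mul hBd.le]
      rw [one_div, inv_mul_cancel₀ hK0.ne', Real.rpow_one]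
    rw [hD2] at hmax'
    obtain ⟨G, hG1, hG2⟩ := est B D a hD ha (by rw [hDK]; ring) (by
      intro J hJ r' c' hr' hc'
      have hJ0 : (0:ℝ) < J := by exact_mod_cast hJ
      have h1 := hmax' J hJ (r ∘ r') (c ∘ c') (hr.comp hr') (hc.comp hc')
      rw [← Matrix.submatrix_submatrix, ← hB] at h1
      set d := ‖(B.submatrix r' c').det‖ with hd
      have hd0 : 0 ≤ d := norm_nonneg _
      have h2 : d ^ ((2:ℝ) / J) ≤ K / J * D ^ 2 := by
        rw [div_mul_eq_mul_div, le_div_iff₀ hJ0]; linarith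
      have h3 : d ^ 2 = (d ^ ((2:ℝ) / J)) ^ J := by
        rw [← Real.rpow_natCast (d ^ ((2:ℝ) / J)), ← Real.rpow_mul hd0, div_mul_cancel₀ _ hJ0.ne']
        norm_num
      rw [h3, pow_mul, ← mul_pow]
      gcongr)
    obtain ⟨s, hs⟩ := dp_main hK A 𝒜 hP ε δ hε hδ0 hδ hdp r c hr hc G (a * D ^ 2) (by positivity)
      hG1 hG2
    refine ⟨xs c s, xs_01 c hc s, ?_⟩
    intro K' hK' _ r' c' hr' hc'
    refine (ENNReal.ofReal_le_ofReal ?_).trans hs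
    refine (hred (K * D ^ 2) (by positivity) hmax' K' hK' r' c' hr' hc').trans (le_of_eq ?_)
    ring
  · push Not at hF
    refine ⟨0, fun i => Or.inl rfl, ?_⟩
    intro K hK _ r c hr hc
    have := hred 0 le_rfl (by
      intro J hJ r c hr hc
      have hJN : J ≤ N := by simpa using Fintype.card_le_of_injective c hc
      exact hF ⟨⟨J, by omega⟩, (r, c)⟩ (by simp [F, hJ, hr, hc])) K hK r c hr hc
    rw [mul_zero] at this
    rw [ENNReal.ofReal_of_nonpos this]
    exact zero_le

end
end

section
/- There exist absolute constants C and C' such that the following holds. Let d ≥ 1, let w ≥ 2, let h : {0,1}^d → {0,1} be computed by a w-DNF formula, let ε > 0 and δ ∈ (0,1). Then there exists an (ε,δ)-differentially private algorithm 𝒜 (with respect to databases x : {0,1}^d → ℝ, where x, x' are neighbors when Σ_{b} |x(b) − x'(b)| ≤ 1) approximating the generalized marginal map x ↦ x∗h, where (x∗h)(a) = Σ_{b ∈ {0,1}^d} x(b)·h(a ⊕ b) and ⊕ is componentwise XOR, whose mean squared error satisfies sup_x 2^{−d}·E[‖𝒜(x) − x∗h‖₂²] ≤ C·(ln(1/δ)/ε²)·2^{d·(1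 − 1/(C'·w·log₂ w))}. -/
open MeasureTheory Finset
open scoped ENNReal NNReal

noncomputable section

/-- `(ε,δ)`-differential privacy for a randomized algorithm taking a database in
histogram form `x : {0,1}^d → ℝ` as input; `x, x'` are neighbors when
`Σ_b |x b − x' b| ≤ 1`. -/
def DiffPrivateDB {d : ℕ} {Ω : Type*} [MeasurableSpace Ω]
    (A : ((Fin d → Bool) → ℝ) → Measure Ω) (ε δ : ℝ) : Prop :=
  ∀ x x' : (Fin d → Bool) → ℝ,
    (∑ b, |x b - x' b|) ≤ 1 →
    ∀ T : Set Ω, MeasurableSet T →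
      A x T ≤ ENNReal.ofReal (Real.exp ε) * A x' T + ENNReal.ofReal δ

/-- `h : {0,1}^d → {0,1}` is computed by a `w`-DNF: there are `s` terms, each a
conjunction of `w` literals (a literal is a variable `c_p` or its negation, encoded by a
pair `(p, polarity)`), and `h c = 1` iff some term is satisfied by `c`. -/
def IsWDNF (d w : ℕ) (h : (Fin d → Bool) → Bool) : Prop :=
  ∃ (s : ℕ) (lit : Fin s → Fin w → Fin d × Bool),
    ∀ c : Fin d → Bool, h c = true ↔ ∃ i, ∀ j, c (lit i j).1 = (lit i j).2

/-- The generalized marginal map `(x ∗ h)(a) = Σ_{b ∈ {0,1}^d} x(b) h(a ⊕ b)`,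
the convolution of `x` and `h` over the group `(ℤ/2ℤ)^d`. -/
def genMarginal {d : ℕ} (x : (Fin d → Bool) → ℝ) (h : (Fin d → Bool) → Bool) :
    (Fin d → Bool) → ℝ :=
  fun a => ∑ b, x b * (if h (fun p => xor (a p) (b p)) then (1 : ℝ) else 0)


namespace GM

variable {d : ℕ}

/-- flip the coordinates of `y` in `A` -/
def fl (y : Fin d → Bool) (A : Finset (Fin d)) : Fin d → Bool :=
  fun p => xor (y p) (decide (p ∈ A))

lemma fl_fl (y : Fin d → Bool) (A : Finset (Fin d)) : fl (fl y A) A = y := by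
  funext p; simp [fl]

lemma fl_empty (y : Fin d → Bool) : fl y ∅ = y := by
  funext p; simp [fl]

def flE (A : Finset (Fin d)) : (Fin d → Bool) ≃ (Fin d → Bool) :=
  ⟨fun y => fl y A, fun y => fl y A, fun y => fl_fl y A, fun y => fl_fl y A⟩

lemma fl_union (y : Fin d → Bool) {A B : Finset (Fin d)} (h : Disjoint A B) :
    fl y (A ∪ B) = fl (fl y A) B := by
  funext p
  have : ¬ (p ∈ A ∧ p ∈ B) := fun hp => (Finset.disjoint_left.mp h hp.1 hp.2)
  simp only [fl, Finset.mem_union]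
  by_cases h1 : p ∈ A <;> by_cases h2 : p ∈ B <;> simp_all

/-- code-counting function -/
def cc (V : (Fin d → Bool) → Finset (Fin d)) : ℕ → Finset (Fin d) → (Fin d → Bool) → ℝ
  | 0, T, _ => if T = ∅ then 1 else 0
  | n + 1, T, z => (if T = ∅ then 1 else 0) +
      ∑ U ∈ (V z).powerset.erase ∅, if U ⊆ T then
        ∑ A ∈ U.powerset, cc V n (T \ U) (fl z A) else 0

lemma cc_nonneg (V : (Fin d → Bool) → Finset (Fin d)) (n : ℕ) (T : Finset (Fin d))
    (z : Fin d → Bool) : 0 ≤ cc V n T z := by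
  induction n generalizing T z with
  | zero => simp only [cc]; split_ifs <;> simp
  | succ n ih =>
    simp only [cc]
    refine add_nonneg (by split_ifs <;> simp) (Finset.sum_nonneg fun U _ => ?_)
    split_ifs
    · exact Finset.sum_nonneg fun A _ => ih _ _
    · exact le_rfl

lemma cc_succ_ge (V : (Fin d → Bool) → Finset (Fin d)) (n : ℕ) (T U A : Finset (Fin d))
    (z : Fin d → Bool) (hU : U ∈ (V z).powerset.erase ∅) (hUT : U ⊆ T) (hA : A ⊆ U) :
    cc V n (T \ U) (fl z A) ≤ cc V (n + 1) T z := by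
  have h1 : cc V n (T \ U) (fl z A) ≤ ∑ A ∈ U.powerset, cc V n (T \ U) (fl z A) :=
    Finset.single_le_sum (f := fun A => cc V n (T \ U) (fl z A))
      (fun A _ => cc_nonneg _ _ _ _) (Finset.mem_powerset.mpr hA)
  have h2 : (if U ⊆ T then ∑ A ∈ U.powerset, cc V n (T \ U) (fl z A) else 0) ≤
      ∑ U ∈ (V z).powerset.erase ∅, if U ⊆ T then
        ∑ A ∈ U.powerset, cc V n (T \ U) (fl z A) else 0 := by
    refine Finset.single_le_sum (f := fun U => if U ⊆ T then
        ∑ A ∈ U.powerset, cc V n (T \ U) (fl z A) else 0) (fun W _ => ?_) hU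
    split_ifs
    · exact Finset.sum_nonneg fun A _ => cc_nonneg _ _ _ _
    · exact le_rfl
  rw [if_pos hUT] at h2
  have h3 : (0 : ℝ) ≤ if T = ∅ then 1 else 0 := by split_ifs <;> simp
  simp only [cc]
  linarith

lemma sum_pow_card (r : ℝ) (V : Finset (Fin d)) :
    ∑ U ∈ V.powerset, r ^ U.card = (1 + r) ^ V.card := by
  have := Finset.sum_pow_mul_eq_add_pow r 1 V
  simpa [add_comm] using this

lemma cc_sum_le (V : (Fin d → Bool) → Finset (Fin d)) (w : ℕ) (hw : 1 ≤ w)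
    (hV : ∀ z, (V z).card ≤ w) (r : ℝ) (hr : r = 1 / (8 * w)) (n : ℕ) (z : Fin d → Bool) :
    ∑ T : Finset (Fin d), r ^ T.card * cc V n T z ≤ 2 := by
  have hw0 : (0 : ℝ) < w := by exact_mod_cast hw
  have hr0 : 0 < r := by rw [hr]; positivity
  have hpow : ∀ z, (1 + 2 * r) ^ (V z).card ≤ 3 / 2 := by
    intro z
    calc (1 + 2 * r) ^ (V z).card ≤ (1 + 2 * r) ^ w :=
          pow_le_pow_right₀ (by linarith) (hV z)
      _ ≤ (Real.exp (2 * r)) ^ w := by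
          apply pow_le_pow_left₀ (by linarith)
          linarith [Real.add_one_le_exp (2 * r)]
      _ = Real.exp (1 / 4) := by
          rw [← Real.exp_nat_mul]; congr 1; rw [hr]; field_simp; norm_num
      _ ≤ 3 / 2 := by
          have h1 : Real.exp (1 / 4) ^ 4 = Real.exp 1 := by
            rw [← Real.exp_nat_mul]; norm_num
          have h2 := Real.exp_one_lt_d9
          by_contra hc
          push Not at hc
          have : (3 / 2 : ℝ) ^ 4 < Real.exp (1 / 4) ^ 4 := pow_lt_pow_left₀ hc (by norm_num) (by norm_num)
          rw [h1] at this
          norm_num at this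
          linarith
  induction n generalizing z with
  | zero => simp [cc]
  | succ n ih =>
    have key : ∀ U : Finset (Fin d), ∑ T : Finset (Fin d), r ^ T.card *
        (if U ⊆ T then ∑ A ∈ U.powerset, cc V n (T \ U) (fl z A) else 0) ≤
        2 * (2 * r) ^ U.card := by
      intro U
      have e1 : ∑ T : Finset (Fin d), r ^ T.card *
        (if U ⊆ T then ∑ A ∈ U.powerset, cc V n (T \ U) (fl z A) else 0)
        = r ^ U.card * ∑ A ∈ U.powerset, ∑ T ∈ Finset.univ.filter (fun T => U ⊆ T),
            r ^ (T \ U).card * cc V n (T \ U) (fl z A) := by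
        rw [Finset.sum_comm, Finset.sum_filter, Finset.mul_sum]
        refine Finset.sum_congr rfl fun T _ => ?_
        split_ifs with h
        · rw [Finset.mul_sum, Finset.mul_sum]
          refine Finset.sum_congr rfl fun A _ => ?_
          rw [← mul_assoc, ← pow_add, ← Finset.card_sdiff_add_card_eq_card h, add_comm]
        · simp
      rw [e1]
      have e2 : ∀ A, ∑ T ∈ Finset.univ.filter (fun T => U ⊆ T),
            r ^ (T \ U).card * cc V n (T \ U) (fl z A) ≤ 2 := by
        intro A
        have inj : Set.InjOn (fun T : Finset (Fin d) => T \ U)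
            (Finset.univ.filter (fun T => U ⊆ T)) := by
          intro T hT T' hT' h
          simp only [Finset.coe_filter, Finset.mem_univ, true_and, Set.mem_ofPred_eq] at hT hT' h
          rw [← Finset.sdiff_union_of_subset hT, h, Finset.sdiff_union_of_subset hT']
        rw [← Finset.sum_image (f := fun T => r ^ T.card * cc V n T (fl z A)) inj]
        refine le_trans (Finset.sum_le_sum_of_subset_of_nonneg (Finset.subset_univ _) ?_) (ih (fl z A))
        intro T _ _
        exact mul_nonneg (by positivity) (cc_nonneg _ _ _ _)
      calc _ ≤ r ^ U.card * ∑ A ∈ U.powerset, (2 : ℝ) := by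
            gcongr with A hA; exact e2 A
        _ = 2 * (2 * r) ^ U.card := by
            simp [Finset.card_powerset, mul_pow]; ring
    calc ∑ T : Finset (Fin d), r ^ T.card * cc V (n + 1) T z
        = 1 + ∑ U ∈ (V z).powerset.erase ∅, ∑ T : Finset (Fin d), r ^ T.card *
        (if U ⊆ T then ∑ A ∈ U.powerset, cc V n (T \ U) (fl z A) else 0) := by
          rw [Finset.sum_comm]
          simp only [cc, mul_add, Finset.sum_add_distrib, Finset.mul_sum]
          simp
      _ ≤ 1 + ∑ U ∈ (V z).powerset.erase ∅, 2 * (2 * r) ^ U.card := by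
          gcongr with U hU; exact key U
      _ = 1 + 2 * ((1 + 2 * r) ^ (V z).card - 1) := by
          rw [← Finset.mul_sum, ← sum_pow_card, ← Finset.sum_erase_add _ _ (Finset.empty_mem_powerset (V z))]
          simp
      _ ≤ 2 := by linarith [hpow z]

/-- signed discrete derivative -/
def DT (T : Finset (Fin d)) (f : (Fin d → Bool) → ℝ) (y : Fin d → Bool) : ℝ :=
  ∑ A ∈ T.powerset, (-1) ^ A.card * f (fl y A)

lemma sum_powerset_split (T U : Finset (Fin d)) (h : U ⊆ T) (g : Finset (Fin d) → ℝ) :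
    ∑ A ∈ T.powerset, g A = ∑ A ∈ U.powerset, ∑ B ∈ (T \ U).powerset, g (A ∪ B) := by
  rw [← Finset.sum_product']
  symm
  refine Finset.sum_bij' (fun p _ => p.1 ∪ p.2) (fun A _ => (A ∩ U, A \ U)) ?_ ?_ ?_ ?_ ?_
  · intro p hp
    simp only [Finset.mem_product, Finset.mem_powerset] at hp ⊢
    exact Finset.union_subset (hp.1.trans h) (hp.2.trans Finset.sdiff_subset)
  · intro A hA
    simp only [Finset.mem_product, Finset.mem_powerset] at hA ⊢
    exact ⟨Finset.inter_subset_right, Finset.sdiff_subset_sdiff hA subset_rfl⟩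
  · rintro ⟨A, B⟩ hp
    simp only [Finset.mem_product, Finset.mem_powerset, Finset.subset_iff, Finset.mem_sdiff] at hp
    ext p <;> simp <;> grind
  · intro A hA
    ext p; simp; tauto
  · intros; rfl

lemma DT_split (T U : Finset (Fin d)) (h : U ⊆ T) (f : (Fin d → Bool) → ℝ) (y : Fin d → Bool) :
    DT T f y = ∑ A ∈ U.powerset, (-1) ^ A.card * DT (T \ U) f (fl y A) := by
  unfold DT
  rw [sum_powerset_split T U h]
  refine Finset.sum_congr rfl fun A hA => ?_
  rw [Finset.mul_sum]
  refine Finset.sum_congr rfl fun B hB => ?_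
  have hd : Disjoint A B := by
    rw [Finset.mem_powerset] at hA hB
    exact (Finset.disjoint_sdiff (s := U) (t := T)).mono hA hB
  rw [fl_union y hd, Finset.card_union_of_disjoint hd, pow_add, mul_assoc]

lemma DT_const (T : Finset (Fin d)) (hT : T ≠ ∅) (f : (Fin d → Bool) → ℝ) (y : Fin d → Bool)
    (c : ℝ) (h : ∀ A ⊆ T, f (fl y A) = c) : DT T f y = 0 := by
  unfold DT
  have : ∑ A ∈ T.powerset, (-1 : ℝ) ^ A.card * f (fl y A) = ∑ A ∈ T.powerset, (-1 : ℝ) ^ A.card * c :=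
    Finset.sum_congr rfl fun A hA => by rw [h A (Finset.mem_powerset.mp hA)]
  rw [this, ← Finset.sum_mul, sum_pow_card]
  have : T.card ≠ 0 := by simpa using hT
  simp [this]

section dnf
variable {s w : ℕ} (lit : Fin s → Fin w → Fin d × Bool)

def sat (i : Fin s) (z : Fin d → Bool) : Prop := ∀ j, z (lit i j).1 = (lit i j).2

def vars (i : Fin s) : Finset (Fin d) := Finset.univ.image fun j => (lit i j).1

open Classical in
def VV (z : Fin d → Bool) : Finset (Fin d) :=
  (Finset.univ.filter fun p => ∃ i, sat lit i z ∧ (∀ i' < i, ¬ sat lit i' z) ∧ p ∈ vars lit i)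

lemma VV_eq (z : Fin d → Bool) (i : Fin s) (h1 : sat lit i z) (h2 : ∀ i' < i, ¬ sat lit i' z) :
    VV lit z = vars lit i := by
  ext p
  simp only [VV, Finset.mem_filter, Finset.mem_univ, true_and]
  constructor
  · rintro ⟨i', h1', h2', hp⟩
    rcases lt_trichotomy i i' with h | h | h
    · exact absurd h1 (h2' _ h)
    · rwa [h]
    · exact absurd h1' (h2 _ h)
  · intro hp; exact ⟨i, h1, h2, hp⟩

lemma VV_card (z : Fin d → Bool) : (VV lit z).card ≤ w := by
  by_cases h : ∃ i, sat lit i z ∧ (∀ i' < i, ¬ sat lit i' z)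
  · obtain ⟨i, h1, h2⟩ := h
    rw [VV_eq lit z i h1 h2]
    exact Finset.card_image_le.trans (by simp)
  · have : VV lit z = ∅ := by
      ext p
      simp only [VV, Finset.mem_filter, Finset.mem_univ, true_and, Finset.notMem_empty, iff_false]
      rintro ⟨i, h1, h2, _⟩
      exact h ⟨i, h1, h2⟩
    simp [this]

lemma exists_code (f : (Fin d → Bool) → ℝ)
    (hf1 : ∀ z, (∃ i, sat lit i z) → f z = 1) (hf0 : ∀ z, (¬ ∃ i, sat lit i z) → f z = 0)
    (n : ℕ) (T : Finset (Fin d)) (hn : T.card ≤ n) (y : Fin d → Bool) (hD : DT T f y ≠ 0) :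
    ∃ A ⊆ T, 1 ≤ cc (VV lit) n T (fl y A) := by
  classical
  induction n generalizing T y with
  | zero =>
    have : T = ∅ := by simpa using hn
    subst this
    exact ⟨∅, by simp, by simp [cc]⟩
  | succ n ih =>
    by_cases hT : T = ∅
    · subst hT
      refine ⟨∅, by simp, ?_⟩
      simp only [cc, if_true]
      have : 0 ≤ ∑ U ∈ (VV lit (fl y ∅)).powerset.erase ∅, (if U ⊆ ∅ then
        ∑ A ∈ U.powerset, cc (VV lit) n (∅ \ U) (fl (fl y ∅) A) else 0) := by
        refine Finset.sum_nonneg fun U _ => ?_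
        split_ifs
        · exact Finset.sum_nonneg fun A _ => cc_nonneg _ _ _ _
        · exact le_rfl
      linarith
    -- first alive term
    have hex : ∃ i, ∃ A ⊆ T, sat lit i (fl y A) := by
      by_contra hc
      push Not at hc
      apply hD
      refine DT_const T hT f y 0 fun A hA => hf0 _ ?_
      rintro ⟨i, hi⟩
      exact hc i A hA hi
    obtain ⟨i, ⟨A0, hA0, hs0⟩, hmin⟩ : ∃ i, (∃ A ⊆ T, sat lit i (fl y A)) ∧
        ∀ i' < i, ¬ (∃ A ⊆ T, sat lit i' (fl y A)) := by
      obtain ⟨i, hi, hm⟩ := WellFounded.has_min (wellFounded_lt (α := Fin s))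
        {i | ∃ A ⊆ T, sat lit i (fl y A)} hex
      exact ⟨i, hi, fun i' hi' h => hm i' h hi'⟩
    obtain ⟨U, hU⟩ : ∃ U, U = vars lit i ∩ T := ⟨_, rfl⟩
    have hUT : U ⊆ T := by rw [hU]; exact Finset.inter_subset_right
    -- a flip agreeing with A0 on vars satisfies term i
    have hsat : ∀ A ⊆ T, (∀ p ∈ U, (p ∈ A ↔ p ∈ A0)) → sat lit i (fl y A) := by
      intro A hA hag j
      rw [← hs0 j]
      have hv : (lit i j).1 ∈ vars lit i := Finset.mem_image_of_mem _ (Finset.mem_univ j)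
      have : ((lit i j).1 ∈ A ↔ (lit i j).1 ∈ A0) := by
        by_cases hpT : (lit i j).1 ∈ T
        · exact hag _ (by rw [hU]; exact Finset.mem_inter.mpr ⟨hv, hpT⟩)
        · exact ⟨fun h => absurd (hA h) hpT, fun h => absurd (hA0 h) hpT⟩
      simp [fl, this]
    have hUne : U ≠ ∅ := by
      intro hUe
      apply hD
      refine DT_const T hT f y 1 fun A hA => hf1 _ ⟨i, hsat A hA ?_⟩
      rw [hUe]; simp
    rw [DT_split T U hUT] at hD
    obtain ⟨A1, hA1, hne⟩ := Finset.exists_ne_zero_of_sum_ne_zero hD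
    have hne' : DT (T \ U) f (fl y A1) ≠ 0 := right_ne_zero_of_mul hne
    rw [Finset.mem_powerset] at hA1
    have hcard : (T \ U).card ≤ n := by
      have h1 := Finset.card_sdiff_add_card_eq_card hUT
      have h2 : 0 < U.card := Finset.card_pos.mpr (Finset.nonempty_iff_ne_empty.mpr hUne)
      omega
    obtain ⟨B, hB, hcB⟩ := ih (T \ U) hcard (fl y A1) hne'
    -- z
    have hBs : B ⊆ T := hB.trans Finset.sdiff_subset
    have hAz : (A0 ∩ U) ∪ B ⊆ T := Finset.union_subset (Finset.inter_subset_right.trans hUT) hBs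
    refine ⟨(A0 ∩ U) ∪ B, hAz, ?_⟩
    have hsz : sat lit i (fl y ((A0 ∩ U) ∪ B)) := by
      refine hsat _ hAz fun p hp => ?_
      have : p ∉ B := fun h => (Finset.mem_sdiff.mp (hB h)).2 hp
      simp [hp, this]
    have hV : VV lit (fl y ((A0 ∩ U) ∪ B)) = vars lit i :=
      VV_eq lit _ i hsz fun i' hi' h => hmin i' hi' ⟨_, hAz, h⟩
    -- flip back
    obtain ⟨A2, hA2⟩ : ∃ A2, A2 = symmDiff (A0 ∩ U) A1 := ⟨_, rfl⟩
    have hA2U : A2 ⊆ U := by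
      intro p hp
      rw [hA2, Finset.mem_symmDiff] at hp
      rcases hp with hp | hp
      · exact (Finset.mem_inter.mp hp.1).2
      · exact hA1 hp.1
    have hfl : fl (fl y ((A0 ∩ U) ∪ B)) A2 = fl (fl y A1) B := by
      funext p
      have h1 : p ∈ B → p ∉ U := fun h => (Finset.mem_sdiff.mp (hB h)).2
      have h2 : p ∈ A1 → p ∈ U := fun h => hA1 h
      simp only [fl, hA2, Finset.mem_union, Finset.mem_symmDiff, Finset.mem_inter]
      by_cases a : p ∈ B <;> by_cases b : p ∈ A1 <;> by_cases c : p ∈ U <;> by_cases e : p ∈ A0 <;>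
        first | exact absurd (h2 b) c | exact absurd c (h1 a) | simp [a, b, c, e]
    have hUm : U ∈ (vars lit i).powerset.erase ∅ := by
      simp only [Finset.mem_erase, Finset.mem_powerset]
      exact ⟨hUne, by rw [hU]; exact Finset.inter_subset_left⟩
    calc (1 : ℝ) ≤ cc (VV lit) n (T \ U) (fl (fl y A1) B) := hcB
      _ = cc (VV lit) n (T \ U) (fl (fl y ((A0 ∩ U) ∪ B)) A2) := by rw [hfl]
      _ ≤ _ := cc_succ_ge _ _ _ _ _ _ (by rw [hV]; exact hUm) hUT hA2U

end dnf

def chi (S : Finset (Fin d)) (y : Fin d → Bool) : ℝ := ∏ i ∈ S, (if y i then -1 else 1)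

def FT (f : (Fin d → Bool) → ℝ) (S : Finset (Fin d)) : ℝ := ∑ a, f a * chi S a

lemma chi_xor (S : Finset (Fin d)) (a b : Fin d → Bool) :
    chi S (fun p => xor (a p) (b p)) = chi S a * chi S b := by
  unfold chi
  rw [← Finset.prod_mul_distrib]
  refine Finset.prod_congr rfl fun i _ => ?_
  beta_reduce
  generalize a i = u
  generalize b i = v
  cases u <;> cases v <;> simp

lemma chi_sq (S : Finset (Fin d)) (a : Fin d → Bool) : chi S a * chi S a = 1 := by
  rw [← chi_xor]; simp [chi]

lemma chi_abs (S : Finset (Fin d)) (a : Fin d → Bool) : |chi S a| = 1 := by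
  have h := chi_sq S a
  rw [← abs_mul_abs_self] at h
  nlinarith [abs_nonneg (chi S a)]

lemma orth1 (a b : Fin d → Bool) :
    ∑ S : Finset (Fin d), chi S a * chi S b = if a = b then (2 : ℝ) ^ d else 0 := by
  have h : ∑ S : Finset (Fin d), chi S a * chi S b
      = ∏ i : Fin d, (1 + (if xor (a i) (b i) then (-1 : ℝ) else 1)) := by
    rw [Finset.prod_one_add, Finset.powerset_univ]
    refine Finset.sum_congr rfl fun S _ => ?_
    rw [← chi_xor]; rfl
  rw [h]
  split_ifs with hab
  · subst hab; simp; norm_num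
  · obtain ⟨i, hi⟩ := Function.ne_iff.mp hab
    refine Finset.prod_eq_zero (Finset.mem_univ i) ?_
    revert hi
    cases a i <;> cases b i <;> simp

lemma orth2 (S T : Finset (Fin d)) :
    ∑ a : Fin d → Bool, chi S a * chi T a = if S = T then (2 : ℝ) ^ d else 0 := by
  have h : ∀ a : Fin d → Bool, chi S a * chi T a = ∏ i : Fin d,
      ((if i ∈ S then (if a i then (-1 : ℝ) else 1) else 1) *
       (if i ∈ T then (if a i then (-1 : ℝ) else 1) else 1)) := by
    intro a
    rw [Finset.prod_mul_distrib]
    simp [chi, Finset.prod_ite_mem]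
  simp_rw [h]
  rw [← Fintype.prod_sum (f := fun (i : Fin d) (x : Bool) => ((if i ∈ S then (if x then (-1 : ℝ) else 1) else 1) *
       (if i ∈ T then (if x then (-1 : ℝ) else 1) else 1)))]
  split_ifs with hST
  · subst hST
    rw [Finset.prod_congr rfl (g := fun _ => (2 : ℝ))]
    · simp
    · intro i _
      by_cases hi : i ∈ S <;> simp only [hi, if_true, if_false, Fintype.sum_bool] <;> norm_num
  · have : ∃ i, ¬ (i ∈ S ↔ i ∈ T) := by
      by_contra hc
      push Not at hc
      exact hST (Finset.ext hc)
    obtain ⟨i, hi⟩ := this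
    refine Finset.prod_eq_zero (Finset.mem_univ i) ?_
    by_cases h1 : i ∈ S <;> by_cases h2 : i ∈ T <;> simp_all

lemma parseval (f : (Fin d → Bool) → ℝ) : ∑ S, FT f S ^ 2 = 2 ^ d * ∑ a, f a ^ 2 := by
  calc ∑ S, FT f S ^ 2 = ∑ S, ∑ a, ∑ b, f a * f b * (chi S a * chi S b) := by
        refine Finset.sum_congr rfl fun S _ => ?_
        rw [sq, FT, Finset.sum_mul_sum]
        refine Finset.sum_congr rfl fun a _ => Finset.sum_congr rfl fun b _ => by ring
    _ = ∑ a, ∑ b, f a * f b * ∑ S, (chi S a * chi S b) := by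
        rw [Finset.sum_comm]
        refine Finset.sum_congr rfl fun a _ => ?_
        rw [Finset.sum_comm]
        refine Finset.sum_congr rfl fun b _ => ?_
        rw [Finset.mul_sum]
    _ = _ := by
        simp_rw [orth1]
        simp [Finset.mul_sum]
        refine Finset.sum_congr rfl fun b _ => by ring

lemma inversion (f : (Fin d → Bool) → ℝ) (a : Fin d → Bool) :
    ∑ S, FT f S * chi S a = 2 ^ d * f a := by
  simp_rw [FT, Finset.sum_mul]
  rw [Finset.sum_comm]
  have : ∀ b, ∑ S, f b * chi S b * chi S a = f b * (if b = a then (2 : ℝ) ^ d else 0) := by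
    intro b
    rw [← orth1, Finset.mul_sum]
    exact Finset.sum_congr rfl fun S _ => by ring
  simp_rw [this]
  simp [mul_comm]

lemma chi_fl (S A : Finset (Fin d)) (y : Fin d → Bool) :
    chi S (fl y A) = chi S y * ∏ i ∈ A, (if i ∈ S then -1 else 1) := by
  have : fl y A = fun p => xor (y p) ((fun p => decide (p ∈ A)) p) := rfl
  rw [this, chi_xor]
  congr 1
  unfold chi
  simp only [decide_eq_true_eq]
  rw [Finset.prod_ite_mem, Finset.prod_ite_mem, Finset.inter_comm]

lemma FT_DT (f : (Fin d → Bool) → ℝ) (T S : Finset (Fin d)) :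
    FT (DT T f) S = if T ⊆ S then 2 ^ T.card * FT f S else 0 := by
  have h1 : ∀ A, ∑ y, f (fl y A) * chi S y = (∏ i ∈ A, (if i ∈ S then (-1 : ℝ) else 1)) * FT f S := by
    intro A
    rw [← (flE A).sum_comp, FT, Finset.mul_sum]
    refine Finset.sum_congr rfl fun y _ => ?_
    change f (fl (fl y A) A) * chi S (fl y A) = _
    rw [fl_fl, chi_fl]; ring
  have h2 : FT (DT T f) S = (∑ A ∈ T.powerset, ∏ i ∈ A, (if i ∈ S then (1 : ℝ) else -1)) * FT f S := by
    unfold FT DT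
    simp_rw [Finset.sum_mul]
    rw [Finset.sum_comm]
    refine Finset.sum_congr rfl fun A _ => ?_
    simp_rw [mul_assoc]
    rw [← Finset.mul_sum, h1, ← mul_assoc, FT]
    congr 1
    rw [← Finset.prod_const, ← Finset.prod_mul_distrib]
    refine Finset.prod_congr rfl fun i _ => ?_
    split_ifs <;> norm_num
  rw [h2, ← Finset.prod_one_add]
  split_ifs with h
  · congr 1
    rw [Finset.prod_congr rfl (g := fun _ => (2 : ℝ))]
    · simp
    · intro i hi; simp [h hi]; norm_num
  · obtain ⟨i, hi, hi'⟩ := Finset.not_subset.mp h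
    rw [Finset.prod_eq_zero hi (by simp [hi']), zero_mul]

section tail
variable {s w : ℕ} (lit : Fin s → Fin w → Fin d × Bool)

lemma DT_abs_le (f : (Fin d → Bool) → ℝ) (hf : ∀ z, |f z| ≤ 1) (T : Finset (Fin d))
    (y : Fin d → Bool) : |DT T f y| ≤ 2 ^ T.card := by
  refine (Finset.abs_sum_le_sum_abs _ _).trans ?_
  calc _ ≤ ∑ A ∈ T.powerset, (1 : ℝ) := by
        refine Finset.sum_le_sum fun A _ => ?_
        simp [abs_mul, hf]
    _ = _ := by simp

lemma level_le (f : (Fin d → Bool) → ℝ)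
    (hf1 : ∀ z, (∃ i, sat lit i z) → f z = 1) (hf0 : ∀ z, (¬ ∃ i, sat lit i z) → f z = 0)
    (T : Finset (Fin d)) :
    ∑ S, (if T ⊆ S then FT f S ^ 2 else 0) ≤ 2 ^ d * (2 ^ T.card * ∑ z, cc (VV lit) d T z) := by
  have hf : ∀ z, |f z| ≤ 1 := by
    intro z
    by_cases h : ∃ i, sat lit i z
    · simp [hf1 z h]
    · simp [hf0 z h]
  have h1 : ∑ S, (if T ⊆ S then FT f S ^ 2 else 0) * (2 ^ T.card) ^ 2 = 2 ^ d * ∑ y, DT T f y ^ 2 := by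
    rw [← parseval]
    refine Finset.sum_congr rfl fun S _ => ?_
    rw [FT_DT]
    split_ifs <;> ring
  have h2 : ∀ y, DT T f y ^ 2 ≤ (2 ^ T.card) ^ 2 * ∑ A ∈ T.powerset, cc (VV lit) d T (fl y A) := by
    intro y
    by_cases hD : DT T f y = 0
    · rw [hD]
      have : 0 ≤ ∑ A ∈ T.powerset, cc (VV lit) d T (fl y A) :=
        Finset.sum_nonneg fun A _ => cc_nonneg _ _ _ _
      simp only [ne_eq, OfNat.ofNat_ne_zero, not_false_eq_true, zero_pow]
      positivity
    · obtain ⟨A, hA, h⟩ := exists_code lit f hf1 hf0 d T (by simpa using Finset.card_le_univ T) y hD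
      have h3 : 1 ≤ ∑ A ∈ T.powerset, cc (VV lit) d T (fl y A) :=
        h.trans (Finset.single_le_sum (f := fun A => cc (VV lit) d T (fl y A))
          (fun A _ => cc_nonneg _ _ _ _) (Finset.mem_powerset.mpr hA))
      have h4 : DT T f y ^ 2 ≤ (2 ^ T.card) ^ 2 := by
        rw [← sq_abs]
        exact pow_le_pow_left₀ (abs_nonneg _) (DT_abs_le f hf T y) 2
      calc _ ≤ (2 ^ T.card) ^ 2 * (1 : ℝ) := by linarith
        _ ≤ _ := by gcongr
  have h3 : ∑ y, ∑ A ∈ T.powerset, cc (VV lit) d T (fl y A) = 2 ^ T.card * ∑ z, cc (VV lit) d T z := by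
    rw [Finset.sum_comm]
    have : ∀ A, ∑ y, cc (VV lit) d T (fl y A) = ∑ z, cc (VV lit) d T z := fun A =>
      (flE A).sum_comp (fun z => cc (VV lit) d T z)
    simp [this]
  have h4 : ∑ y, DT T f y ^ 2 ≤ (2 ^ T.card) ^ 2 * (2 ^ T.card * ∑ z, cc (VV lit) d T z) := by
    rw [← h3, Finset.mul_sum]
    exact Finset.sum_le_sum fun y _ => h2 y
  rw [← Finset.sum_mul] at h1
  have hp : (0 : ℝ) < (2 ^ T.card) ^ 2 := by positivity
  refine le_of_mul_le_mul_right ?_ hp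
  rw [h1]
  calc _ ≤ (2 : ℝ) ^ d * ((2 ^ T.card) ^ 2 * (2 ^ T.card * ∑ z, cc (VV lit) d T z)) := by gcongr
    _ = _ := by ring

lemma moment_le (hw : 1 ≤ w) (f : (Fin d → Bool) → ℝ)
    (hf1 : ∀ z, (∃ i, sat lit i z) → f z = 1) (hf0 : ∀ z, (¬ ∃ i, sat lit i z) → f z = 0) :
    ∑ S, (1 + 1 / (16 * w : ℝ)) ^ S.card * FT f S ^ 2 ≤ 2 * (2 ^ d) ^ 2 := by
  set μ : ℝ := 1 / (16 * w : ℝ) with hμ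
  have hμ0 : 0 ≤ μ := by positivity
  calc ∑ S, (1 + μ) ^ S.card * FT f S ^ 2
      = ∑ T : Finset (Fin d), μ ^ T.card * ∑ S, (if T ⊆ S then FT f S ^ 2 else 0) := by
        simp_rw [Finset.mul_sum]
        rw [Finset.sum_comm]
        refine Finset.sum_congr rfl fun S _ => ?_
        rw [← sum_pow_card, Finset.sum_mul]
        simp only [mul_ite, mul_zero]
        rw [← Finset.sum_filter]
        refine Finset.sum_congr ?_ fun _ _ => rfl
        ext T; simp
    _ ≤ ∑ T : Finset (Fin d), μ ^ T.card * (2 ^ d * (2 ^ T.card * ∑ z, cc (VV lit) d T z)) := by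
        refine Finset.sum_le_sum fun T _ => ?_
        exact mul_le_mul_of_nonneg_left (level_le lit f hf1 hf0 T) (by positivity)
    _ = 2 ^ d * ∑ z, ∑ T, (2 * μ) ^ T.card * cc (VV lit) d T z := by
        rw [Finset.sum_comm (s := (Finset.univ : Finset (Fin d → Bool))), Finset.mul_sum]
        refine Finset.sum_congr rfl fun T _ => ?_
        rw [← Finset.mul_sum, mul_pow]; ring
    _ ≤ 2 ^ d * ∑ z : Fin d → Bool, (2 : ℝ) := by
        gcongr with z hz
        refine cc_sum_le (VV lit) w hw (VV_card lit) _ ?_ d z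
        rw [hμ]
        have : (0 : ℝ) < w := by exact_mod_cast hw
        field_simp; norm_num
    _ = _ := by simp; ring

end tail

section laplace
set_option linter.unusedSectionVars false

def lap (b x : ℝ) : ℝ := 1 / (2 * b) * Real.exp (-(|x| / b))

lemma lap_nonneg {b : ℝ} (hb : 0 < b) (x : ℝ) : 0 ≤ lap b x := by unfold lap; positivity

lemma lap_cont (b : ℝ) : Continuous (lap b) := by unfold lap; fun_prop

lemma lap_shift {b : ℝ} (hb : 0 < b) (x y : ℝ) : lap b x ≤ Real.exp (|x - y| / b) * lap b y := by
  unfold lap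
  rw [mul_left_comm, ← Real.exp_add]
  gcongr
  rw [← sub_eq_add_neg, neg_eq_zero_sub, sub_le_sub_iff, zero_add, ← add_div]
  gcongr
  have := abs_sub_abs_le_abs_sub y x
  rw [abs_sub_comm] at this
  linarith

lemma lap_int_aux {b : ℝ} (hb : 0 < b) (n : ℕ) :
    ∫ x, |x| ^ n * lap b |x| = b ^ n * Real.Gamma (n + 1) := by
  rw [integral_comp_abs (f := fun x => x ^ n * lap b x)]
  have h := Real.integral_rpow_mul_exp_neg_mul_Ioi (a := n + 1) (r := 1 / b) (by positivity) (by positivity)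
  have h2 : ∫ x in Set.Ioi (0 : ℝ), x ^ n * lap b x
      = ∫ x in Set.Ioi (0 : ℝ), 1 / (2 * b) * (x ^ ((n : ℝ) + 1 - 1) * Real.exp (-(1 / b * x))) := by
    refine setIntegral_congr_fun measurableSet_Ioi fun x hx => ?_
    have hx' : 0 < x := hx
    simp only [lap, abs_of_pos hx', add_sub_cancel_right, Real.rpow_natCast]
    rw [one_div_mul_eq_div b x]
    ring
  rw [h2, integral_const_mul, h]
  have : (1 / (1 / b)) ^ ((n : ℝ) + 1) = b ^ n * b := by
    rw [one_div_one_div, Real.rpow_add hb, Real.rpow_natCast, Real.rpow_one]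
  rw [this]
  field_simp

lemma lap_abs (b x : ℝ) : lap b |x| = lap b x := by simp [lap]

lemma lap_int0 {b : ℝ} (hb : 0 < b) : ∫ x, lap b x = 1 := by
  have := lap_int_aux hb 0
  simpa [lap_abs] using this

lemma lap_int2 {b : ℝ} (hb : 0 < b) : ∫ x, lap b x * x ^ 2 = 2 * b ^ 2 := by
  have := lap_int_aux hb 2
  have h3 : Real.Gamma ((2 : ℕ) + 1) = 2 := by
    rw [Real.Gamma_nat_eq_factorial]; norm_num [Nat.factorial]
  rw [h3] at this
  simp only [lap_abs, sq_abs] at this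
  simp_rw [mul_comm (lap b _)]
  rw [this]; ring

lemma lap_integrable0 {b : ℝ} (hb : 0 < b) : Integrable (lap b) := by
  by_contra h
  have := integral_undef h
  rw [lap_int0 hb] at this
  exact one_ne_zero this

lemma lap_integrable2 {b : ℝ} (hb : 0 < b) : Integrable (fun x => lap b x * x ^ 2) := by
  by_contra h
  have := integral_undef h
  rw [lap_int2 hb] at this
  have : 0 < 2 * b ^ 2 := by positivity
  linarith

lemma lap_integrable1 {b : ℝ} (hb : 0 < b) : Integrable (fun x => lap b x * x) := by
  refine ((lap_integrable0 hb).add (lap_integrable2 hb)).mono'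
    ((lap_cont b).mul continuous_id).aestronglyMeasurable (Filter.Eventually.of_forall fun x => ?_)
  have h := lap_nonneg hb x
  simp only [Real.norm_eq_abs, abs_mul, abs_of_nonneg h, Pi.add_apply]
  have : |x| ≤ 1 + x ^ 2 := by rw [← sq_abs]; nlinarith [sq_nonneg (|x| - 1)]
  nlinarith

lemma lap_int1 (b : ℝ) : ∫ x, lap b x * x = 0 := by
  have h := integral_neg_eq_self (fun x => lap b x * x) volume
  have h2 : ∀ x, lap b (-x) * (-x) = -(lap b x * x) := by intro x; simp [lap]
  simp_rw [h2] at h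
  rw [integral_neg] at h
  linarith

variable {ι : Type*} [Fintype ι] [DecidableEq ι]

def dens (b : ι → ℝ) (z : ι → ℝ) : ℝ := ∏ i, lap (b i) (z i)

lemma dens_nonneg {b : ι → ℝ} (hb : ∀ i, 0 < b i) (z : ι → ℝ) : 0 ≤ dens b z :=
  Finset.prod_nonneg fun i _ => lap_nonneg (hb i) _

lemma dens_cont (b : ι → ℝ) : Continuous (dens b) :=
  continuous_finsetProd _ fun i _ => (lap_cont (b i)).comp (continuous_apply i)

lemma dens_int {b : ι → ℝ} (hb : ∀ i, 0 < b i) : ∫ z, dens b z = 1 := by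
  unfold dens
  rw [integral_fintype_prod_volume_eq_prod (f := fun i x => lap (b i) x)]
  simp [lap_int0 (hb _)]

lemma dens_integrable {b : ι → ℝ} (hb : ∀ i, 0 < b i) : Integrable (dens b) :=
  Integrable.fintype_prod (f := fun i x => lap (b i) x) fun i => lap_integrable0 (hb i)

def fac (b : ι → ℝ) (j k i : ι) (x : ℝ) : ℝ :=
  lap (b i) x * ((if i = j then x else 1) * (if i = k then x else 1))

lemma fac_prod (b : ι → ℝ) (j k : ι) (z : ι → ℝ) :
    ∏ i, fac b j k i (z i) = dens b z * (z j * z k) := by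
  unfold fac dens
  rw [Finset.prod_mul_distrib, Finset.prod_mul_distrib]
  simp

lemma fac_integrable {b : ι → ℝ} (hb : ∀ i, 0 < b i) (j k i : ι) : Integrable (fac b j k i) := by
  unfold fac
  by_cases h1 : i = j <;> by_cases h2 : i = k <;> simp only [h1, h2, if_true, if_false, one_mul, mul_one]
  all_goals first
    | exact lap_integrable0 (hb _)
    | exact lap_integrable1 (hb _)
    | (simp only [← sq]; exact lap_integrable2 (hb _))
    | (split_ifs <;> first
        | simpa using lap_integrable0 (hb _)
        | simpa using lap_integrable1 (hb _)
        | simpa [← sq] using lap_integrable2 (hb _))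

lemma dens_mom_integrable {b : ι → ℝ} (hb : ∀ i, 0 < b i) (j k : ι) :
    Integrable (fun z : ι → ℝ => dens b z * (z j * z k)) := by
  simp_rw [← fac_prod]
  exact Integrable.fintype_prod (f := fun i x => fac b j k i x) fun i => fac_integrable hb j k i

lemma dens_mom {b : ι → ℝ} (hb : ∀ i, 0 < b i) (j k : ι) :
    ∫ z : ι → ℝ, dens b z * (z j * z k) = if j = k then 2 * b j ^ 2 else 0 := by
  simp_rw [← fac_prod]
  rw [integral_fintype_prod_volume_eq_prod (f := fun i x => fac b j k i x)]
  split_ifs with h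
  · subst h
    have : ∀ i, ∫ x, fac b j j i x = if i = j then 2 * b j ^ 2 else 1 := by
      intro i
      split_ifs with h
      · subst h
        simp only [fac, if_true, ← sq]
        exact lap_int2 (hb i)
      · simp only [fac, if_neg h, mul_one]
        exact lap_int0 (hb i)
    simp [this]
  · refine Finset.prod_eq_zero (Finset.mem_univ j) ?_
    simp only [fac, if_true, if_neg h, mul_one]
    exact lap_int1 _

lemma dens_quad {b : ι → ℝ} (hb : ∀ i, 0 < b i) (c : ι → ℝ) :
    Integrable (fun z : ι → ℝ => dens b z * (∑ j, c j * z j) ^ 2) ∧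
    ∫ z : ι → ℝ, dens b z * (∑ j, c j * z j) ^ 2 = ∑ j, c j ^ 2 * (2 * b j ^ 2) := by
  have h : (fun z : ι → ℝ => dens b z * (∑ j, c j * z j) ^ 2) =
      fun z => ∑ j, ∑ k, (c j * c k) * (dens b z * (z j * z k)) := by
    funext z
    rw [sq, Finset.sum_mul_sum, Finset.mul_sum]
    refine Finset.sum_congr rfl fun j _ => ?_
    rw [Finset.mul_sum]
    exact Finset.sum_congr rfl fun k _ => by ring
  have hi : ∀ j k, Integrable (fun z : ι → ℝ => (c j * c k) * (dens b z * (z j * z k))) :=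
    fun j k => (dens_mom_integrable hb j k).const_mul _
  rw [h]
  refine ⟨integrable_finsetSum _ fun j _ => integrable_finsetSum _ fun k _ => hi j k, ?_⟩
  rw [integral_finsetSum _ fun j _ => integrable_finsetSum _ fun k _ => hi j k]
  refine Finset.sum_congr rfl fun j _ => ?_
  rw [integral_finsetSum _ fun k _ => hi j k]
  simp_rw [integral_const_mul, dens_mom hb]
  simp [sq]

/-- product Laplace measure with centre `m` and scales `b` -/
def LM (b m : ι → ℝ) : Measure (ι → ℝ) :=
  (volume : Measure (ι → ℝ)).withDensity fun z => ENNReal.ofReal (dens b (z - m))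

lemma LM_meas (b m : ι → ℝ) : Measurable fun z => ENNReal.ofReal (dens b (z - m)) := by
  have := dens_cont b
  exact (this.comp (continuous_id.sub continuous_const)).measurable.ennreal_ofReal

lemma LM_prob {b : ι → ℝ} (hb : ∀ i, 0 < b i) (m : ι → ℝ) : IsProbabilityMeasure (LM b m) := by
  constructor
  rw [LM, withDensity_apply _ MeasurableSet.univ, Measure.restrict_univ,
    ← ofReal_integral_eq_lintegral_ofReal ((dens_integrable hb).comp_sub_right m)
      (Filter.Eventually.of_forall fun z => dens_nonneg hb _),
    integral_sub_right_eq_self (fun z => dens b z) m, dens_int hb, ENNReal.ofReal_one]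

lemma LM_dp {b : ι → ℝ} (hb : ∀ i, 0 < b i) (m m' : ι → ℝ) (ε : ℝ)
    (h : ∑ i, |m i - m' i| / b i ≤ ε) (T : Set (ι → ℝ)) (hT : MeasurableSet T) :
    LM b m T ≤ ENNReal.ofReal (Real.exp ε) * LM b m' T := by
  rw [LM, LM, withDensity_apply _ hT, withDensity_apply _ hT, ← lintegral_const_mul _ (LM_meas b m')]
  refine lintegral_mono fun z => ?_
  rw [← ENNReal.ofReal_mul (Real.exp_pos _).le]
  refine ENNReal.ofReal_le_ofReal ?_
  calc dens b (z - m) ≤ ∏ i, (Real.exp (|m i - m' i| / b i) * lap (b i) ((z - m') i)) := by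
        refine Finset.prod_le_prod (fun i _ => lap_nonneg (hb i) _) fun i _ => ?_
        have := lap_shift (hb i) ((z - m) i) ((z - m') i)
        have e : (z - m) i - (z - m') i = -(m i - m' i) := by simp
        rwa [e, abs_neg] at this
    _ = Real.exp (∑ i, |m i - m' i| / b i) * dens b (z - m') := by
        rw [Finset.prod_mul_distrib, Real.exp_sum, dens]
    _ ≤ _ := by
        have := dens_nonneg hb (z - m')
        gcongr

lemma LM_quad {b : ι → ℝ} (hb : ∀ i, 0 < b i) (m c : ι → ℝ) :
    ∫⁻ z, ENNReal.ofReal ((∑ j, c j * (z j - m j)) ^ 2) ∂(LM b m)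
      = ENNReal.ofReal (∑ j, c j ^ 2 * (2 * b j ^ 2)) := by
  have hm : Measurable fun z : ι → ℝ => ENNReal.ofReal ((∑ j, c j * (z j - m j)) ^ 2) := by
    fun_prop
  rw [LM, lintegral_withDensity_eq_lintegral_mul _ (LM_meas b m) hm]
  obtain ⟨h1, h2⟩ := dens_quad hb c
  rw [← h2, ← integral_sub_right_eq_self _ m, ofReal_integral_eq_lintegral_ofReal (h1.comp_sub_right m)]
  · refine lintegral_congr fun z => ?_
    simp only [Pi.mul_apply]
    rw [← ENNReal.ofReal_mul (dens_nonneg hb _)]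
    rfl
  · exact Filter.Eventually.of_forall fun z => mul_nonneg (dens_nonneg hb _) (sq_nonneg _)

end laplace

section final

lemma sum_sq_chi (u : Finset (Fin d) → ℝ) :
    ∑ a, ((2 ^ d : ℝ)⁻¹ * ∑ S, u S * chi S a) ^ 2 = (2 ^ d : ℝ)⁻¹ * ∑ S, u S ^ 2 := by
  have h1 : ∀ a : Fin d → Bool, ((2 ^ d : ℝ)⁻¹ * ∑ S, u S * chi S a) ^ 2 =
      ((2 ^ d : ℝ)⁻¹) ^ 2 * ∑ S, ∑ T, u S * u T * (chi S a * chi T a) := by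
    intro a
    rw [mul_pow, sq (∑ S, u S * chi S a), Finset.sum_mul_sum]
    congr 1
    exact Finset.sum_congr rfl fun S _ => Finset.sum_congr rfl fun T _ => by ring
  simp_rw [h1]
  rw [← Finset.mul_sum, Finset.sum_comm]
  have h2 : ∀ S, ∑ a, ∑ T, u S * u T * (chi S a * chi T a) = u S ^ 2 * 2 ^ d := by
    intro S
    rw [Finset.sum_comm]
    simp_rw [← Finset.mul_sum, orth2]
    simp [sq]
  simp_rw [h2]
  rw [← Finset.sum_mul]
  have : (2 ^ d : ℝ) ≠ 0 := by positivity
  field_simp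

def ind (h : (Fin d → Bool) → Bool) (z : Fin d → Bool) : ℝ := if h z then 1 else 0

lemma gm_eq (x : (Fin d → Bool) → ℝ) (h : (Fin d → Bool) → Bool) (a : Fin d → Bool) :
    genMarginal x h a = (2 ^ d : ℝ)⁻¹ * ∑ S, (FT (ind h) S * FT x S) * chi S a := by
  have h1 : ∀ b, (if h (fun p => xor (a p) (b p)) then (1 : ℝ) else 0) =
      (2 ^ d : ℝ)⁻¹ * ∑ S, FT (ind h) S * (chi S a * chi S b) := by
    intro b
    simp_rw [← chi_xor]
    rw [inversion, ind, inv_mul_cancel_left₀ (by positivity)]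
  unfold genMarginal
  simp_rw [h1]
  simp_rw [mul_left_comm (x _), ← Finset.mul_sum]
  congr 1
  simp_rw [Finset.mul_sum]
  rw [Finset.sum_comm]
  refine Finset.sum_congr rfl fun S _ => ?_
  conv_rhs => rw [FT, FT, mul_right_comm, Finset.mul_sum]
  refine Finset.sum_congr rfl fun b _ => ?_
  rw [FT]; ring

abbrev JJ (d : ℕ) := Finset (Fin d) ⊕ (Fin d → Bool)

def cf (t : ℕ) (S : Finset (Fin d)) : JJ d → ℝ
  | Sum.inl S' => if S.card ≤ t then (if S' = S then 1 else 0) else 0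
  | Sum.inr b => if S.card ≤ t then 0 else chi S b

def mm (t : ℕ) (x : (Fin d → Bool) → ℝ) : JJ d → ℝ
  | Sum.inl S => if S.card ≤ t then FT x S else 0
  | Sum.inr b => x b

def bb (d : ℕ) (β γ : ℝ) : JJ d → ℝ
  | Sum.inl _ => β
  | Sum.inr _ => γ

lemma cf_mm (t : ℕ) (S : Finset (Fin d)) (x : (Fin d → Bool) → ℝ) :
    ∑ j, cf t S j * mm t x j = FT x S := by
  rw [Fintype.sum_sum_type]
  by_cases hS : S.card ≤ t
  · simp only [cf, mm, hS, if_true, zero_mul, Finset.sum_const_zero, add_zero]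
    rw [Finset.sum_eq_single S (fun b _ hb => by simp [hb]) (fun hb => absurd (Finset.mem_univ S) hb)]
    simp [hS]
  · simp only [cf, mm, hS, if_false, zero_mul, Finset.sum_const_zero, zero_add, FT]
    exact Finset.sum_congr rfl fun b _ => mul_comm _ _

lemma cf_var (t : ℕ) (S : Finset (Fin d)) (β γ : ℝ) :
    ∑ j, cf t S j ^ 2 * (2 * bb d β γ j ^ 2) =
      if S.card ≤ t then 2 * β ^ 2 else 2 ^ d * (2 * γ ^ 2) := by
  rw [Fintype.sum_sum_type]
  by_cases hS : S.card ≤ t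
  · simp [cf, bb, hS]
  · have : ∀ b, chi S b ^ 2 = 1 := fun b => by rw [sq, chi_sq]
    simp [cf, bb, hS, this]

def post (t : ℕ) (h : (Fin d → Bool) → Bool) (z : JJ d → ℝ) (a : Fin d → Bool) : ℝ :=
  (2 ^ d : ℝ)⁻¹ * ∑ S, (FT (ind h) S * ∑ j, cf t S j * z j) * chi S a

lemma post_meas (t : ℕ) (h : (Fin d → Bool) → Bool) : Measurable (post t h) := by
  unfold post
  fun_prop

lemma post_err (t : ℕ) (h : (Fin d → Bool) → Bool) (x : (Fin d → Bool) → ℝ) (z : JJ d → ℝ) :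
    ∑ a, (post t h z a - genMarginal x h a) ^ 2 =
      (2 ^ d : ℝ)⁻¹ * ∑ S, (FT (ind h) S * ∑ j, cf t S j * (z j - mm t x j)) ^ 2 := by
  rw [← sum_sq_chi]
  refine Finset.sum_congr rfl fun a _ => ?_
  rw [gm_eq, post, ← mul_sub, ← Finset.sum_sub_distrib]
  refine congrArg (fun r : ℝ => ((2 ^ d : ℝ)⁻¹ * r) ^ 2) (Finset.sum_congr rfl fun S _ => ?_)
  simp_rw [mul_sub (cf t S _)]
  rw [Finset.sum_sub_distrib, cf_mm]
  ring

lemma mech_err (t : ℕ) (h : (Fin d → Bool) → Bool) (x : (Fin d → Bool) → ℝ) (β γ : ℝ)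
    (hβ : 0 < β) (hγ : 0 < γ) :
    ∫⁻ y, ∑ a, (‖y a - genMarginal x h a‖₊ : ℝ≥0∞) ^ 2 ∂((LM (bb d β γ) (mm t x)).map (post t h)) =
    ENNReal.ofReal ((2 ^ d : ℝ)⁻¹ * ∑ S, FT (ind h) S ^ 2 *
      (if S.card ≤ t then 2 * β ^ 2 else 2 ^ d * (2 * γ ^ 2))) := by
  have hb : ∀ j, 0 < bb d β γ j := by rintro (j | j) <;> simp [bb, hβ, hγ]
  rw [lintegral_map (by fun_prop) (post_meas t h)]
  have h1 : ∀ z, ∑ a, (‖post t h z a - genMarginal x h a‖₊ : ℝ≥0∞) ^ 2 =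
      ∑ S, ENNReal.ofReal ((2 ^ d : ℝ)⁻¹ * FT (ind h) S ^ 2) *
        ENNReal.ofReal ((∑ j, cf t S j * (z j - mm t x j)) ^ 2) := by
    intro z
    have e1 : ∀ r : ℝ, (‖r‖₊ : ℝ≥0∞) ^ 2 = ENNReal.ofReal (r ^ 2) := by
      intro r
      rw [← enorm_eq_nnnorm, Real.enorm_eq_ofReal_abs, ← ENNReal.ofReal_pow (abs_nonneg _), sq_abs]
    simp_rw [e1]
    rw [← ENNReal.ofReal_sum_of_nonneg (fun a _ => sq_nonneg _), post_err, Finset.mul_sum,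
      ENNReal.ofReal_sum_of_nonneg (fun S _ => by positivity)]
    refine Finset.sum_congr rfl fun S _ => ?_
    rw [← ENNReal.ofReal_mul (by positivity)]
    congr 1; ring
  simp_rw [h1]
  rw [lintegral_finsetSum _ (fun S _ => by fun_prop), Finset.mul_sum,
    ENNReal.ofReal_sum_of_nonneg (fun S _ => by split_ifs <;> positivity)]
  refine Finset.sum_congr rfl fun S _ => ?_
  rw [lintegral_const_mul _ (by fun_prop), LM_quad hb, cf_var, ← ENNReal.ofReal_mul (by positivity),
    mul_assoc]

def NN (d t : ℕ) : ℕ := (Finset.univ.filter fun S : Finset (Fin d) => S.card ≤ t).card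

lemma NN_pos (d t : ℕ) : 0 < NN d t := Finset.card_pos.mpr ⟨∅, by simp⟩

lemma FT_sub_le (x x' : (Fin d → Bool) → ℝ) (S : Finset (Fin d)) :
    |FT x S - FT x' S| ≤ ∑ b, |x b - x' b| := by
  unfold FT
  rw [← Finset.sum_sub_distrib]
  refine (Finset.abs_sum_le_sum_abs _ _).trans (Finset.sum_le_sum fun b _ => ?_)
  rw [← sub_mul, abs_mul, chi_abs, mul_one]

lemma mm_shift (t : ℕ) (x x' : (Fin d → Bool) → ℝ) (hx : ∑ b, |x b - x' b| ≤ 1) (ε : ℝ) (hε : 0 < ε) :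
    ∑ j, |mm t x j - mm t x' j| / bb d (2 * NN d t / ε) (2 / ε) j ≤ ε := by
  have hN : (0 : ℝ) < NN d t := by exact_mod_cast NN_pos d t
  rw [Fintype.sum_sum_type]
  simp only [mm, bb]
  rw [← Finset.sum_div, ← Finset.sum_div]
  have h1 : ∑ S : Finset (Fin d), |(if S.card ≤ t then FT x S else 0) - (if S.card ≤ t then FT x' S else 0)|
      ≤ NN d t := by
    calc _ ≤ ∑ S : Finset (Fin d), (if S.card ≤ t then (1 : ℝ) else 0) := by
          refine Finset.sum_le_sum fun S _ => ?_
          split_ifs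
          · exact (FT_sub_le x x' S).trans hx
          · simp
      _ = _ := by simp [NN]
  calc _ ≤ (NN d t : ℝ) / (2 * NN d t / ε) + 1 / (2 / ε) := by gcongr
    _ = ε := by field_simp; norm_num

lemma NN_sq_le (d : ℕ) : (NN d (d / 16) : ℝ) ^ 2 ≤ (2 : ℝ) ^ ((d : ℝ) * (7 / 8)) := by
  set t := d / 16 with ht
  have h1 : (NN d t : ℝ) * (1 / 8) ^ t ≤ (9 / 8) ^ d := by
    have e := sum_pow_card (1 / 8 : ℝ) (Finset.univ : Finset (Fin d))
    rw [Finset.powerset_univ, Finset.card_univ, Fintype.card_fin] at e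
    have : (1 + 1 / 8 : ℝ) = 9 / 8 := by norm_num
    rw [this] at e
    rw [← e, NN, ← nsmul_eq_mul, ← Finset.sum_const]
    refine le_trans (Finset.sum_le_sum (g := fun S : Finset (Fin d) => (1 / 8 : ℝ) ^ S.card) fun S hS => ?_) (Finset.sum_le_sum_of_subset_of_nonneg (Finset.subset_univ _) fun S _ _ => by positivity)
    exact pow_le_pow_of_le_one (by norm_num) (by norm_num) (Finset.mem_filter.mp hS).2
  have h2 : (NN d t : ℝ) ≤ 8 ^ t * (9 / 8) ^ d := by
    rw [one_div, inv_pow, ← div_eq_mul_inv, div_le_iff₀ (by positivity)] at h1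
    linarith
  have h3 : (NN d t : ℝ) ^ 2 ≤ 64 ^ t * (81 / 64) ^ d := by
    calc _ ≤ ((8 : ℝ) ^ t * (9 / 8) ^ d) ^ 2 := by gcongr
      _ = _ := by
        rw [mul_pow, ← pow_mul, ← pow_mul, mul_comm t, mul_comm d, pow_mul, pow_mul]; norm_num
  have h4 : (81 / 64 : ℝ) ≤ (2 : ℝ) ^ (1 / 2 : ℝ) := by
    rw [← Real.sqrt_eq_rpow]
    exact Real.le_sqrt_of_sq_le (by norm_num)
  have h5 : (64 : ℝ) ^ t ≤ (2 : ℝ) ^ ((d : ℝ) * (3 / 8)) := by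
    have : (64 : ℝ) ^ t = (2 : ℝ) ^ ((6 * t : ℝ)) := by
      have : (64 : ℝ) = 2 ^ 6 := by norm_num
      rw [this, ← pow_mul, ← Real.rpow_natCast]; push_cast; rfl
    rw [this]
    apply Real.rpow_le_rpow_of_exponent_le (by norm_num)
    have : 16 * t ≤ d := Nat.mul_div_le d 16
    have : (16 * t : ℝ) ≤ d := by exact_mod_cast this
    linarith
  calc _ ≤ _ := h3
    _ ≤ (2 : ℝ) ^ ((d : ℝ) * (3 / 8)) * ((2 : ℝ) ^ (1 / 2 : ℝ)) ^ d := by gcongr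
    _ = _ := by
      rw [← Real.rpow_natCast, ← Real.rpow_mul (by norm_num), ← Real.rpow_add (by norm_num)]
      congr 1; ring

lemma lam_le (d w : ℕ) (hw : 1 ≤ w) :
    (2 : ℝ) ^ ((d : ℝ) / (256 * w)) ≤ (1 + 1 / (16 * w : ℝ)) ^ (d / 16 + 1) := by
  have hw0 : (1 : ℝ) ≤ w := by exact_mod_cast hw
  have h1 : (2 : ℝ) ^ (1 / (16 * w : ℝ)) ≤ 1 + 1 / (16 * w : ℝ) := by
    have := rpow_one_add_le_one_add_mul_self (s := 1) (p := 1 / (16 * w : ℝ)) (by norm_num)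
      (by positivity) (by rw [div_le_one (by positivity)]; linarith)
    norm_num at this ⊢
    exact this
  calc _ ≤ ((2 : ℝ) ^ (1 / (16 * w : ℝ))) ^ (d / 16 + 1) := by
        rw [← Real.rpow_natCast, ← Real.rpow_mul (by norm_num)]
        apply Real.rpow_le_rpow_of_exponent_le (by norm_num)
        have : d ≤ 16 * (d / 16 + 1) := by omega
        have : (d : ℝ) ≤ 16 * ((d / 16 + 1 : ℕ) : ℝ) := by exact_mod_cast this
        rw [div_mul_eq_mul_div, one_mul, div_le_div_iff₀ (by positivity) (by positivity)]
        nlinarith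
    _ ≤ _ := by gcongr

lemma total_bound (d w : ℕ) (hw : 2 ≤ w) (h : (Fin d → Bool) → Bool) (hh : IsWDNF d w h)
    (ε : ℝ) (hε : 0 < ε) :
    (2 ^ d : ℝ)⁻¹ * ((2 ^ d : ℝ)⁻¹ * ∑ S, FT (ind h) S ^ 2 *
      (if S.card ≤ d / 16 then 2 * (2 * NN d (d / 16) / ε) ^ 2 else 2 ^ d * (2 * (2 / ε) ^ 2)))
    ≤ 24 / ε ^ 2 * (2 : ℝ) ^ ((d : ℝ) * (1 - 1 / (256 * w * Real.logb 2 w))) := by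
  obtain ⟨s, lit, hl⟩ := hh
  have hw2 : (2 : ℝ) ≤ w := by exact_mod_cast hw
  have hlog : 1 ≤ Real.logb 2 w := by
    rw [Real.le_logb_iff_rpow_le (by norm_num) (by linarith)]; simpa using hw2
  have hf1 : ∀ z, (∃ i, sat lit i z) → ind h z = 1 := fun z hz => by
    simp [ind, (hl z).mpr hz]
  have hf0 : ∀ z, (¬ ∃ i, sat lit i z) → ind h z = 0 := fun z hz => by
    have : ¬ h z = true := fun hc => hz ((hl z).mp hc)
    simp [ind, this]
  have hmom := moment_le lit (by omega) (ind h) hf1 hf0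
  set t := d / 16 with ht
  set lam : ℝ := 1 + 1 / (16 * w : ℝ) with hlam
  have hlam1 : 1 ≤ lam := by rw [hlam]; have : 0 ≤ 1 / (16 * w : ℝ) := by positivity
                             linarith
  have hD : (0 : ℝ) < 2 ^ d := by positivity
  have hall : ∑ S, FT (ind h) S ^ 2 ≤ (2 ^ d : ℝ) ^ 2 := by
    rw [parseval, sq]
    gcongr
    calc _ ≤ ∑ a : Fin d → Bool, (1 : ℝ) := by
          refine Finset.sum_le_sum fun a _ => ?_
          unfold ind; split_ifs <;> norm_num
      _ = _ := by simp
  have hpt : ∀ S : Finset (Fin d), FT (ind h) S ^ 2 *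
      (if S.card ≤ t then 2 * (2 * NN d t / ε) ^ 2 else 2 ^ d * (2 * (2 / ε) ^ 2)) ≤
      8 / ε ^ 2 * (NN d t ^ 2 * FT (ind h) S ^ 2 +
        2 ^ d / lam ^ (t + 1) * (lam ^ S.card * FT (ind h) S ^ 2)) := by
    intro S
    split_ifs with hS
    · have e : FT (ind h) S ^ 2 * (2 * (2 * NN d t / ε) ^ 2) =
        8 / ε ^ 2 * (NN d t ^ 2 * FT (ind h) S ^ 2) := by field_simp; ring
      rw [e]
      gcongr
      have : 0 ≤ 2 ^ d / lam ^ (t + 1) * (lam ^ S.card * FT (ind h) S ^ 2) := by positivity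
      linarith
    · have e : FT (ind h) S ^ 2 * (2 ^ d * (2 * (2 / ε) ^ 2)) =
        8 / ε ^ 2 * (2 ^ d * FT (ind h) S ^ 2) := by field_simp; norm_num
      rw [e]
      gcongr
      have h1 : 1 ≤ lam ^ S.card / lam ^ (t + 1) := by
        rw [one_le_div (by positivity)]
        exact pow_le_pow_right₀ hlam1 (by omega)
      have h2 : 0 ≤ (NN d t : ℝ) ^ 2 * FT (ind h) S ^ 2 := by positivity
      calc 2 ^ d * FT (ind h) S ^ 2 ≤ (lam ^ S.card / lam ^ (t + 1)) * (2 ^ d * FT (ind h) S ^ 2) :=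
            le_mul_of_one_le_left (by positivity) h1
        _ = 2 ^ d / lam ^ (t + 1) * (lam ^ S.card * FT (ind h) S ^ 2) := by ring
        _ ≤ _ := by linarith
  have hsum := Finset.sum_le_sum fun S (_ : S ∈ (Finset.univ : Finset (Finset (Fin d)))) => hpt S
  rw [← Finset.mul_sum, Finset.sum_add_distrib, ← Finset.mul_sum, ← Finset.mul_sum] at hsum
  have hN := NN_sq_le d
  have hL := lam_le d w (by omega)
  set E : ℝ := (2 : ℝ) ^ ((d : ℝ) * (1 - 1 / (256 * w * Real.logb 2 w))) with hE
  have hNE : (NN d t : ℝ) ^ 2 ≤ E := by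
    refine hN.trans (Real.rpow_le_rpow_of_exponent_le (by norm_num) ?_)
    gcongr
    have : 1 / (256 * w * Real.logb 2 w) ≤ 1 / 8 := by
      apply one_div_le_one_div_of_le (by norm_num)
      nlinarith
    linarith
  have hLE : 2 ^ d / lam ^ (t + 1) ≤ E := by
    calc 2 ^ d / lam ^ (t + 1) ≤ 2 ^ d / (2 : ℝ) ^ ((d : ℝ) / (256 * w)) := by gcongr
      _ = (2 : ℝ) ^ ((d : ℝ) - (d : ℝ) / (256 * w)) := by
          rw [Real.rpow_sub (by norm_num), Real.rpow_natCast]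
      _ ≤ E := by
          apply Real.rpow_le_rpow_of_exponent_le (by norm_num)
          rw [mul_sub, mul_one, mul_one_div]
          have : (d : ℝ) / (256 * w * Real.logb 2 w) ≤ d / (256 * w) := by
            exact div_le_div_of_nonneg_left (by positivity) (by positivity)
              (le_mul_of_one_le_right (by positivity) hlog)
          linarith
  have hE0 : 0 ≤ E := by positivity
  calc _ ≤ (2 ^ d : ℝ)⁻¹ * ((2 ^ d : ℝ)⁻¹ * (8 / ε ^ 2 * (NN d t ^ 2 * ∑ S, FT (ind h) S ^ 2 +
        2 ^ d / lam ^ (t + 1) * ∑ S, lam ^ S.card * FT (ind h) S ^ 2))) := by gcongr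
    _ ≤ (2 ^ d : ℝ)⁻¹ * ((2 ^ d : ℝ)⁻¹ * (8 / ε ^ 2 * (E * (2 ^ d) ^ 2 + E * (2 * (2 ^ d) ^ 2)))) := by
        gcongr
    _ = _ := by field_simp; ring

end final
end GM

theorem generalized_marginals :
    ∃ C C' : ℝ, 0 < C ∧ 0 < C' ∧
      ∀ (d w : ℕ), 1 ≤ d → 2 ≤ w →
      ∀ h : (Fin d → Bool) → Bool, IsWDNF d w h →
      ∀ ε δ : ℝ, 0 < ε → 0 < δ → δ < 1 →
      ∃ A : ((Fin d → Bool) → ℝ) → Measure ((Fin d → Bool) → ℝ),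
        (∀ x, IsProbabilityMeasure (A x)) ∧
        DiffPrivateDB A ε δ ∧
        (⨆ x : (Fin d → Bool) → ℝ, ((2 ^ d : ℝ≥0∞))⁻¹ *
            ∫⁻ y, ∑ a, (‖y a - genMarginal x h a‖₊ : ℝ≥0∞) ^ 2 ∂(A x))
          ≤ ENNReal.ofReal (C * (Real.log (1 / δ) / ε ^ 2) *
              (2 : ℝ) ^ ((d : ℝ) * (1 - 1 / (C' * w * Real.logb 2 w)))) := by
  refine ⟨24, 256, by norm_num, by norm_num, ?_⟩
  intro d w _ hw h hh ε δ hε hδ hδ1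
  have hN : (0 : ℝ) < GM.NN d (d / 16) := by exact_mod_cast GM.NN_pos d (d / 16)
  have hβ : 0 < 2 * GM.NN d (d / 16) / ε := by positivity
  have hγ : 0 < 2 / ε := by positivity
  have hb : ∀ j, 0 < GM.bb d (2 * GM.NN d (d / 16) / ε) (2 / ε) j := by
    rintro (j | j)
    · exact hβ
    · exact hγ
  have hsum : ENNReal.ofReal δ + ENNReal.ofReal (1 - δ) = 1 := by
    rw [← ENNReal.ofReal_add hδ.le (by linarith)]; simp
  let M : ((Fin d → Bool) → ℝ) → Measure ((Fin d → Bool) → ℝ) := fun x =>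
    (GM.LM (GM.bb d (2 * GM.NN d (d / 16) / ε) (2 / ε)) (GM.mm (d / 16) x)).map (GM.post (d / 16) h)
  have hMp : ∀ x, IsProbabilityMeasure (M x) := fun x => by
    have := GM.LM_prob hb (GM.mm (d / 16) x)
    exact Measure.isProbabilityMeasure_map (GM.post_meas (d / 16) h).aemeasurable
  refine ⟨fun x => ENNReal.ofReal δ • Measure.dirac (genMarginal x h) + ENNReal.ofReal (1 - δ) • M x,
    ?_, ?_, ?_⟩
  · intro x
    have := hMp x
    constructor
    simp [hsum]
  · intro x x' hx T hT
    simp only [Measure.add_apply, Measure.smul_apply, smul_eq_mul]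
    have h1 : M x T ≤ ENNReal.ofReal (Real.exp ε) * M x' T := by
      simp only [M]
      rw [Measure.map_apply (GM.post_meas _ h) hT, Measure.map_apply (GM.post_meas _ h) hT]
      exact GM.LM_dp hb _ _ ε (GM.mm_shift _ x x' hx ε hε) _ (GM.post_meas _ h hT)
    have h2 : (Measure.dirac (genMarginal x h)) T ≤ 1 := prob_le_one
    calc _ ≤ ENNReal.ofReal δ * 1 + ENNReal.ofReal (1 - δ) * (ENNReal.ofReal (Real.exp ε) * M x' T) := by
          gcongr
      _ = ENNReal.ofReal (Real.exp ε) * (ENNReal.ofReal (1 - δ) * M x' T) + ENNReal.ofReal δ := by ring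
      _ ≤ _ := by
          gcongr
          exact le_add_self
  · refine iSup_le fun x => ?_
    rw [lintegral_add_measure, lintegral_smul_measure, lintegral_smul_measure, lintegral_dirac]
    simp only [sub_self, nnnorm_zero, ENNReal.coe_zero, ne_eq, OfNat.ofNat_ne_zero,
      not_false_eq_true, zero_pow, Finset.sum_const_zero, smul_eq_mul, mul_zero, zero_add, M]
    rw [GM.mech_err _ h x _ _ hβ hγ]
    have e2 : ((2 ^ d : ℝ≥0∞))⁻¹ = ENNReal.ofReal ((2 ^ d : ℝ)⁻¹) := by
      rw [ENNReal.ofReal_inv_of_pos (by positivity), ENNReal.ofReal_pow (by norm_num)]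
      simp
    rw [e2, mul_left_comm, ← ENNReal.ofReal_mul (by positivity), ← ENNReal.ofReal_mul (by linarith)]
    refine ENNReal.ofReal_le_ofReal ?_
    have hlog : 1 - δ ≤ Real.log (1 / δ) := by
      rw [one_div, Real.log_inv]
      linarith [Real.log_le_sub_one_of_pos hδ]
    have hB := GM.total_bound d w hw h hh ε hε
    have hE0 : 0 ≤ (2 : ℝ) ^ ((d : ℝ) * (1 - 1 / (256 * w * Real.logb 2 w))) := by positivity
    calc _ ≤ (1 - δ) * (24 / ε ^ 2 * (2 : ℝ) ^ ((d : ℝ) * (1 - 1 / (256 * w * Real.logb 2 w)))) :=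
          mul_le_mul_of_nonneg_left hB (by linarith)
      _ ≤ Real.log (1 / δ) * (24 / ε ^ 2 * (2 : ℝ) ^ ((d : ℝ) * (1 - 1 / (256 * w * Real.logb 2 w)))) :=
          mul_le_mul_of_nonneg_right hlog (by positivity)
      _ = _ := by ring

end
end
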